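/- arXiv:1409.7585 — 3 statements merged into one kernel-verified Lean document; each statement's English description precedes it below -/
import Mathlib

section
/- Every 3-extremal of the Euclidean unit ball 𝔹_n is a 3-geodesic; that is, if f : 𝔻 → 𝔹_n is holomorphic and for every choice of pairwise distinct λ₁, λ₂, λ₃ ∈ 𝔻 there is no map holomorphic on a neighborhood of the closed unit disc with values in 𝔹_n interpolating f at λ₁, λ₂, λ₃, then there exists a holomorphic F : 𝔹_n → 𝔻 such that F∘f is a non-constant Blaschke product of degree at most 2. -/
open Complex Metric Set Filter

noncomputable section

/-- The open unit disc `𝔻` in `ℂ`. -/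
def unitDisc : Set ℂ := Metric.ball (0 : ℂ) 1

/-- The Möbius function `m_α(λ) = (λ - α)/(1 - conj α · λ)`. -/
def mobius (a z : ℂ) : ℂ := (z - a) / (1 - (starRingEnd ℂ) a * z)

/-- `B` agrees on the unit disc with a finite Blaschke product
`ζ · ∏_{j=1}^k m_{α_j}` of degree `k` (here `ζ ∈ 𝕋`, `α_j ∈ 𝔻`). -/
def IsBlaschkeOn (B : ℂ → ℂ) (k : ℕ) : Prop :=
  ∃ (ζ : ℂ) (α : Fin k → ℂ), ‖ζ‖ = 1 ∧ (∀ j, ‖α j‖ < 1) ∧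
    ∀ z ∈ unitDisc, B z = ζ * ∏ j, mobius (α j) z

variable {E : Type*} [NormedAddCommGroup E] [NormedSpace ℂ E]

/-- `f` is a weak `m`-extremal for the nodes `lam` with respect to the domain `D`:
there is no map `h`, holomorphic on an open neighborhood of the closed unit disc
with values in `D`, interpolating `f` at all the nodes. -/
def WeakExtremalFor (D : Set E) (f : ℂ → E) {m : ℕ} (lam : Fin m → ℂ) : Prop :=
  ¬ ∃ (U : Set ℂ) (h : ℂ → E), IsOpen U ∧ Metric.closedBall (0 : ℂ) 1 ⊆ U ∧
      DifferentiableOn ℂ h U ∧ Set.MapsTo h U D ∧ ∀ j, h (lam j) = f (lam j)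

/-- `f` is a weak `m`-extremal of `D`: it is a weak `m`-extremal for some
pairwise distinct nodes in the unit disc. -/
def IsWeakExtremal (D : Set E) (f : ℂ → E) (m : ℕ) : Prop :=
  ∃ lam : Fin m → ℂ, Function.Injective lam ∧ (∀ j, lam j ∈ unitDisc) ∧
    WeakExtremalFor D f lam

/-- `f` is an `m`-extremal of `D`: it is a weak `m`-extremal for every choice of
pairwise distinct nodes in the unit disc. -/
def IsExtremal (D : Set E) (f : ℂ → E) (m : ℕ) : Prop :=
  ∀ lam : Fin m → ℂ, Function.Injective lam → (∀ j, lam j ∈ unitDisc) →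
    WeakExtremalFor D f lam

/-- `f` is an `m`-geodesic of `D`: there is a holomorphic `F : D → 𝔻` such that
`F ∘ f` is a non-constant Blaschke product of degree at most `m - 1`. -/
def IsGeodesic (D : Set E) (f : ℂ → E) (m : ℕ) : Prop :=
  ∃ F : E → ℂ, DifferentiableOn ℂ F D ∧ Set.MapsTo F D unitDisc ∧
    ∃ k : ℕ, 1 ≤ k ∧ k ≤ m - 1 ∧ IsBlaschkeOn (fun z => F (f z)) k

/-- A domain `D ⊆ ℂⁿ` is `k`-balanced (quasi-balanced) if
`(λ^{k₁} z₁, …, λ^{k_n} z_n) ∈ D` for all `λ` in the closed unit disc, `z ∈ D`. -/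
def QuasiBalanced {n : ℕ} (k : Fin n → ℕ) (D : Set (Fin n → ℂ)) : Prop :=
  ∀ l : ℂ, ‖l‖ ≤ 1 → ∀ z ∈ D, (fun j => l ^ k j * z j) ∈ D

/-- The complex ellipsoid `E(p) = {z ∈ ℂⁿ : Σ_j |z_j|^{2 p_j} < 1}`. -/
def ellipsoid {n : ℕ} (p : Fin n → ℝ) : Set (Fin n → ℂ) :=
  {z | ∑ j, ‖z j‖ ^ (2 * p j) < 1}

/-- The Euclidean unit ball `𝔹_n ⊆ ℂⁿ`. -/
def euclideanBall (n : ℕ) : Set (Fin n → ℂ) :=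
  {z | ∑ j, ‖z j‖ ^ 2 < 1}

section Mobius

lemma one_sub_conj_mul_ne_zero {a z : ℂ} (ha : ‖a‖ < 1) (hz : ‖z‖ ≤ 1) :
    1 - (starRingEnd ℂ) a * z ≠ 0 := by
  intro h
  have h1 : (starRingEnd ℂ) a * z = 1 := (sub_eq_zero.1 h).symm
  have h2 : ‖a‖ * ‖z‖ = 1 := by simpa using congrArg norm h1
  nlinarith [norm_nonneg a, norm_nonneg z]

lemma mem_unitDisc {z : ℂ} : z ∈ unitDisc ↔ ‖z‖ < 1 := by
  simp [unitDisc]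

lemma mobius_kernel {a z w : ℂ} (ha : ‖a‖ < 1) (hz : ‖z‖ ≤ 1) (hw : ‖w‖ ≤ 1) :
    1 - mobius a z * (starRingEnd ℂ) (mobius a w) =
      (1 - a * (starRingEnd ℂ) a) * (1 - z * (starRingEnd ℂ) w) /
        ((1 - (starRingEnd ℂ) a * z) * (1 - a * (starRingEnd ℂ) w)) := by
  have h1 := one_sub_conj_mul_ne_zero ha hz
  have h2 : 1 - a * (starRingEnd ℂ) w ≠ 0 := by
    simpa using (map_ne_zero (starRingEnd ℂ)).2 (one_sub_conj_mul_ne_zero ha hw)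
  simp only [mobius, map_div₀, map_sub, map_mul, map_one, conj_conj]
  generalize (starRingEnd ℂ) a = b at *
  rw [div_mul_div_comm, eq_div_iff (mul_ne_zero h1 h2), sub_mul,
    div_mul_cancel₀ _ (mul_ne_zero h1 h2)]
  ring

lemma one_sub_norm_sq_mobius {a z : ℂ} (ha : ‖a‖ < 1) (hz : ‖z‖ ≤ 1) :
    1 - ‖mobius a z‖ ^ 2 =
      (1 - ‖a‖ ^ 2) * (1 - ‖z‖ ^ 2) / ‖1 - (starRingEnd ℂ) a * z‖ ^ 2 := by
  have h := mobius_kernel ha hz hz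
  have h3 : (1 - a * (starRingEnd ℂ) z) = (starRingEnd ℂ) (1 - (starRingEnd ℂ) a * z) := by simp
  rw [h3] at h
  simp only [mul_conj, normSq_eq_norm_sq] at h
  exact_mod_cast h

lemma norm_mobius_lt_one {a z : ℂ} (ha : ‖a‖ < 1) (hz : ‖z‖ < 1) : ‖mobius a z‖ < 1 := by
  have h := one_sub_norm_sq_mobius ha hz.le
  have h1 : 0 < ‖1 - (starRingEnd ℂ) a * z‖ := norm_pos_iff.2 (one_sub_conj_mul_ne_zero ha hz.le)
  have h2 : 0 < 1 - ‖a‖ ^ 2 := by nlinarith [norm_nonneg a]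
  have h3 : 0 < 1 - ‖z‖ ^ 2 := by nlinarith [norm_nonneg z]
  have : 0 < 1 - ‖mobius a z‖ ^ 2 := by rw [h]; positivity
  nlinarith [norm_nonneg (mobius a z)]

lemma norm_mobius_le_one {a z : ℂ} (ha : ‖a‖ < 1) (hz : ‖z‖ ≤ 1) : ‖mobius a z‖ ≤ 1 := by
  have h := one_sub_norm_sq_mobius ha hz
  have h2 : 0 ≤ 1 - ‖a‖ ^ 2 := by nlinarith [norm_nonneg a]
  have h3 : 0 ≤ 1 - ‖z‖ ^ 2 := by nlinarith [norm_nonneg z]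
  have : 0 ≤ 1 - ‖mobius a z‖ ^ 2 := by rw [h]; positivity
  nlinarith [norm_nonneg (mobius a z)]

lemma mobius_neg_mobius {a z : ℂ} (ha : ‖a‖ < 1) (hz : ‖z‖ ≤ 1) :
    mobius (-a) (mobius a z) = z := by
  have h1 := one_sub_conj_mul_ne_zero ha hz
  have h2 := one_sub_conj_mul_ne_zero ha ha.le
  have h3 : 1 - (starRingEnd ℂ) (-a) * mobius a z ≠ 0 :=
    one_sub_conj_mul_ne_zero (by simpa using ha) (norm_mobius_le_one ha hz)
  rw [mobius, div_eq_iff h3]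
  have h4 : mobius a z * (1 - (starRingEnd ℂ) a * z) = z - a := div_mul_cancel₀ _ h1
  rw [map_neg]
  linear_combination h4

lemma differentiableOn_mobius (a : ℂ) :
    DifferentiableOn ℂ (mobius a) {z | 1 - (starRingEnd ℂ) a * z ≠ 0} := by
  intro z hz
  have : DifferentiableAt ℂ (fun z => (z - a) / (1 - (starRingEnd ℂ) a * z)) z :=
    DifferentiableAt.div (by fun_prop) (by fun_prop) hz
  exact this.differentiableWithinAt

lemma differentiableOn_mobius_unitDisc {a : ℂ} (ha : ‖a‖ < 1) :
    DifferentiableOn ℂ (mobius a) unitDisc :=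
  (differentiableOn_mobius a).mono fun _ hz =>
    one_sub_conj_mul_ne_zero ha (mem_unitDisc.1 hz).le

@[simp] lemma mobius_self (a : ℂ) : mobius a a = 0 := by simp [mobius]

@[simp] lemma mobius_zero_left (z : ℂ) : mobius 0 z = z := by simp [mobius]

end Mobius

section BallAutomorphism

variable {V : Type*} [NormedAddCommGroup V] [InnerProductSpace ℂ V]

/-- The involutive automorphism of the unit ball of `V` that exchanges `a` and `0`. -/
def ballAut (a x : V) : V :=
  (1 - inner ℂ a x)⁻¹ • (a - ((√(1 - ‖a‖ ^ 2) : ℝ) : ℂ) • x -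
    (inner ℂ a x / (1 + ((√(1 - ‖a‖ ^ 2) : ℝ) : ℂ))) • a)

lemma inner_self_eq_ofReal_norm_sq (x : V) : inner ℂ x x = ((‖x‖ ^ 2 : ℝ) : ℂ) := by
  rw [inner_self_eq_norm_sq_to_K]
  simp

lemma one_sub_inner_ne_zero {a x : V} (ha : ‖a‖ < 1) (hx : ‖x‖ ≤ 1) :
    1 - inner ℂ a x ≠ 0 := by
  intro h
  have h1 : inner ℂ a x = 1 := (sub_eq_zero.1 h).symm
  have h2 := norm_inner_le_norm (𝕜 := ℂ) a x
  rw [h1, norm_one] at h2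
  nlinarith [norm_nonneg a, norm_nonneg x]

lemma one_sub_inner_ne_zero' {a x : V} (ha : ‖a‖ < 1) (hx : ‖x‖ ≤ 1) :
    1 - inner ℂ x a ≠ 0 := by
  rw [← inner_conj_symm]
  simpa using (map_ne_zero (starRingEnd ℂ)).2 (one_sub_inner_ne_zero ha hx)

lemma inner_self_eq_one_sub_sqrt_sq {a : V} (ha : ‖a‖ < 1) :
    inner ℂ a a = 1 - ((√(1 - ‖a‖ ^ 2) : ℝ) : ℂ) ^ 2 := by
  have h : 0 ≤ 1 - ‖a‖ ^ 2 := by nlinarith [norm_nonneg a]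
  rw [inner_self_eq_ofReal_norm_sq, ← ofReal_pow, Real.sq_sqrt h]
  simp

lemma one_add_sqrt_ne_zero (t : ℝ) : (1 : ℂ) + ((√t : ℝ) : ℂ) ≠ 0 := by
  have : (0 : ℝ) < 1 + √t := by positivity
  exact_mod_cast this.ne'

lemma ballAut_kernel {a x y : V} (ha : ‖a‖ < 1) (hx : ‖x‖ ≤ 1) (hy : ‖y‖ ≤ 1) :
    1 - inner ℂ (ballAut a y) (ballAut a x) =
      (1 - inner ℂ a a) * (1 - inner ℂ y x) / ((1 - inner ℂ a x) * (1 - inner ℂ y a)) := by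
  have h1 := one_sub_inner_ne_zero ha hx
  have h2 := one_sub_inner_ne_zero' ha hy
  have h3 := one_add_sqrt_ne_zero (1 - ‖a‖ ^ 2)
  have h4 := inner_self_eq_one_sub_sqrt_sq ha
  simp only [ballAut, inner_smul_left, inner_smul_right, inner_sub_left, inner_sub_right, map_sub,
    map_inv₀, map_div₀, map_add, map_one, conj_ofReal, inner_conj_symm, h4]
  field_simp
  ring

@[simp] lemma ballAut_zero (a : V) : ballAut a 0 = a := by simp [ballAut]

lemma ballAut_self {a : V} (ha : ‖a‖ < 1) : ballAut a a = 0 := by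
  have h3 := one_add_sqrt_ne_zero (1 - ‖a‖ ^ 2)
  have h4 := inner_self_eq_one_sub_sqrt_sq ha
  rw [ballAut, h4]
  have : a - ((√(1 - ‖a‖ ^ 2) : ℝ) : ℂ) • a -
      ((1 - ((√(1 - ‖a‖ ^ 2) : ℝ) : ℂ) ^ 2) / (1 + ((√(1 - ‖a‖ ^ 2) : ℝ) : ℂ))) • a = 0 := by
    match_scalars
    field_simp
    ring
  rw [this, smul_zero]

lemma norm_ballAut_lt_one {a x : V} (ha : ‖a‖ < 1) (hx : ‖x‖ < 1) : ‖ballAut a x‖ < 1 := by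
  have h := ballAut_kernel ha hx.le hx.le
  have h1 := one_sub_inner_ne_zero ha hx.le
  rw [show (1 - inner ℂ x a) = (starRingEnd ℂ) (1 - inner ℂ a x) by simp, mul_conj,
    normSq_eq_norm_sq] at h
  simp only [inner_self_eq_ofReal_norm_sq] at h
  have h5 : 1 - ‖ballAut a x‖ ^ 2 = (1 - ‖a‖ ^ 2) * (1 - ‖x‖ ^ 2) / ‖1 - inner ℂ a x‖ ^ 2 := by
    exact_mod_cast h
  have h6 : 0 < ‖1 - inner ℂ a x‖ := norm_pos_iff.2 h1
  have h2 : 0 < 1 - ‖a‖ ^ 2 := by nlinarith [norm_nonneg a]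
  have h3 : 0 < 1 - ‖x‖ ^ 2 := by nlinarith [norm_nonneg x]
  have : 0 < 1 - ‖ballAut a x‖ ^ 2 := by rw [h5]; positivity
  nlinarith [norm_nonneg (ballAut a x)]

lemma mapsTo_ballAut {a : V} (ha : ‖a‖ < 1) : MapsTo (ballAut a) (ball 0 1) (ball 0 1) := by
  intro x hx
  rw [mem_ball_zero_iff] at *
  exact norm_ballAut_lt_one ha hx

lemma ballAut_ballAut {a x : V} (ha : ‖a‖ < 1) (hx : ‖x‖ ≤ 1) :
    ballAut a (ballAut a x) = x := by
  have h1 := one_sub_inner_ne_zero ha hx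
  have h3 := one_add_sqrt_ne_zero (1 - ‖a‖ ^ 2)
  have h4 := inner_self_eq_one_sub_sqrt_sq ha
  have hs : ((√(1 - ‖a‖ ^ 2) : ℝ) : ℂ) ≠ 0 := by
    have : 0 < 1 - ‖a‖ ^ 2 := by nlinarith [norm_nonneg a]
    exact_mod_cast (Real.sqrt_pos.2 this).ne'
  have h5 : inner ℂ a (ballAut a x) =
      (1 - ((√(1 - ‖a‖ ^ 2) : ℝ) : ℂ) ^ 2 - inner ℂ a x) / (1 - inner ℂ a x) := by
    simp only [ballAut, inner_smul_right, inner_sub_right, h4]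
    field_simp
    ring
  have h6 : 1 - inner ℂ a (ballAut a x) =
      ((√(1 - ‖a‖ ^ 2) : ℝ) : ℂ) ^ 2 / (1 - inner ℂ a x) := by
    rw [h5]
    field_simp
    ring
  rw [ballAut, h6, h5, ballAut]
  clear h4 h5 h6
  generalize ((√(1 - ‖a‖ ^ 2) : ℝ) : ℂ) = s at *
  generalize inner ℂ a x = ξ at *
  match_scalars <;> field_simp
  ring

lemma differentiableOn_ballAut {a : V} (ha : ‖a‖ < 1) :
    DifferentiableOn ℂ (ballAut a) (ball 0 1) := by
  intro x hx
  have h1 := one_sub_inner_ne_zero ha (mem_ball_zero_iff.1 hx).le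
  have hi : Differentiable ℂ fun x : V => inner ℂ a x := (innerSL ℂ a).differentiable
  refine DifferentiableAt.differentiableWithinAt ?_
  unfold ballAut
  refine DifferentiableAt.smul (DifferentiableAt.inv ?_ h1) ?_
  · exact (hi x).const_sub 1
  · refine DifferentiableAt.sub (by fun_prop) ?_
    have h : DifferentiableAt ℂ (fun x : V => inner ℂ a x / (1 + ((√(1 - ‖a‖ ^ 2) : ℝ) : ℂ))) x := by
      simpa only [div_eq_mul_inv] using (hi x).mul_const _
    exact h.smul_const a

end BallAutomorphism

section SchurAlgorithm

variable {V : Type*} [NormedAddCommGroup V] [InnerProductSpace ℂ V]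

lemma strictConvexSpace_of_complex_inner : StrictConvexSpace ℝ V := by
  have : UniformConvexSpace V :=
    letI := InnerProductSpace.rclikeToReal ℂ V
    inferInstance
  infer_instance

/-- Schwarz lemma with strictness alternative for maps of the disc into the unit ball vanishing
at `p`. -/
lemma exists_mobius_factor [CompleteSpace V] {g : ℂ → V} {p : ℂ} (hp : ‖p‖ < 1)
    (hg : DifferentiableOn ℂ g unitDisc) (hgD : MapsTo g unitDisc (ball 0 1)) (hgp : g p = 0) :
    ∃ φ : ℂ → V, DifferentiableOn ℂ φ unitDisc ∧
      ((∃ v, ‖v‖ = 1 ∧ ∀ z ∈ unitDisc, φ z = v) ∨ MapsTo φ unitDisc (ball 0 1)) ∧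
      ∀ z ∈ unitDisc, g z = mobius p z • φ z := by
  have hp' : ‖-p‖ < 1 := by simpa using hp
  have hm : MapsTo (mobius p) unitDisc unitDisc := fun z hz =>
    mem_unitDisc.2 (norm_mobius_lt_one hp (mem_unitDisc.1 hz))
  have hm' : MapsTo (mobius (-p)) unitDisc unitDisc := fun z hz =>
    mem_unitDisc.2 (norm_mobius_lt_one hp' (mem_unitDisc.1 hz))
  set k : ℂ → V := g ∘ mobius (-p) with hk
  have hk0 : k 0 = 0 := by simp [hk, mobius, hgp]
  have hkd : DifferentiableOn ℂ k unitDisc :=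
    hg.comp (differentiableOn_mobius_unitDisc hp') hm'
  have hkD : MapsTo k unitDisc (ball 0 1) := hgD.comp hm'
  have hkz : ∀ z, k z = z • dslope k 0 z := fun z => by
    simpa [hk0] using (sub_smul_dslope k 0 z).symm
  have hbound : ∀ z ∈ unitDisc, ‖dslope k 0 z‖ ≤ 1 := fun z hz => by
    have := norm_dslope_le_div_of_mapsTo_ball hkd
      (hkD.mono_right (by rw [hk0]; exact ball_subset_closedBall)) hz
    simpa using this
  have hφd : DifferentiableOn ℂ (dslope k 0 ∘ mobius p) unitDisc :=
    ((differentiableOn_dslope (isOpen_ball.mem_nhds (mem_ball_self one_pos))).2 hkd).comp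
      (differentiableOn_mobius_unitDisc hp) hm
  refine ⟨dslope k 0 ∘ mobius p, hφd, ?_, fun z hz => ?_⟩
  · by_cases h : ∃ c ∈ unitDisc, ‖(dslope k 0 ∘ mobius p) c‖ = 1
    · obtain ⟨c, hc, hc1⟩ := h
      have : StrictConvexSpace ℝ V := strictConvexSpace_of_complex_inner
      refine Or.inl ⟨_, hc1, fun z hz => ?_⟩
      refine eqOn_of_isPreconnected_of_isMaxOn_norm (convex_ball _ _).isPreconnected isOpen_ball
        hφd hc (fun w hw => ?_) hz
      exact (hbound _ (hm hw)).trans_eq hc1.symm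
    · push Not at h
      exact Or.inr fun z hz => mem_ball_zero_iff.2
        (lt_of_le_of_ne (hbound _ (hm hz)) (h z hz))
  · rw [Function.comp_apply, ← hkz, hk, Function.comp_apply,
      mobius_neg_mobius hp (mem_unitDisc.1 hz).le]

lemma exists_schur_transform [CompleteSpace V] {f : ℂ → V} {p : ℂ} (hp : p ∈ unitDisc)
    (hf : DifferentiableOn ℂ f unitDisc) (hfD : MapsTo f unitDisc (ball 0 1)) :
    ∃ φ : ℂ → V, DifferentiableOn ℂ φ unitDisc ∧
      ((∃ v, ‖v‖ = 1 ∧ ∀ z ∈ unitDisc, φ z = v) ∨ MapsTo φ unitDisc (ball 0 1)) ∧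
      ∀ z ∈ unitDisc, ballAut (f p) (f z) = mobius p z • φ z := by
  have ha : ‖f p‖ < 1 := mem_ball_zero_iff.1 (hfD hp)
  exact exists_mobius_factor (g := ballAut (f p) ∘ f) (mem_unitDisc.1 hp)
    ((differentiableOn_ballAut ha).comp hf hfD) ((mapsTo_ballAut ha).comp hfD) (ballAut_self ha)

/-- The Schur transform at the first node turns a weak extremal into a weak extremal for the
remaining nodes. -/
lemma WeakExtremalFor.schur_transform {m : ℕ} {lam : Fin (m + 1) → ℂ} {f φ : ℂ → V}
    (hlam : ∀ j, lam j ∈ unitDisc) (hfD : MapsTo f unitDisc (ball 0 1))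
    (hφ : ∀ z ∈ unitDisc, ballAut (f (lam 0)) (f z) = mobius (lam 0) z • φ z)
    (h : WeakExtremalFor (ball 0 1) f lam) :
    WeakExtremalFor (ball 0 1) φ (Fin.tail lam) := by
  rintro ⟨U, g, hU, hUc, hg, hgD, hgi⟩
  have hp : ‖lam 0‖ < 1 := mem_unitDisc.1 (hlam 0)
  have ha : ‖f (lam 0)‖ < 1 := mem_ball_zero_iff.1 (hfD (hlam 0))
  set U₁ : Set ℂ := U ∩ {z | 1 - (starRingEnd ℂ) (lam 0) * z ≠ 0}
  have hU₁ : IsOpen U₁ := hU.inter (isOpen_ne_fun (by fun_prop) (by fun_prop))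
  have hk : DifferentiableOn ℂ (fun z => mobius (lam 0) z • g z) U₁ :=
    ((differentiableOn_mobius _).mono inter_subset_right).smul (hg.mono inter_subset_left)
  refine h ⟨U₁ ∩ (fun z => mobius (lam 0) z • g z) ⁻¹' ball 0 1,
    fun z => ballAut (f (lam 0)) (mobius (lam 0) z • g z),
    hk.continuousOn.isOpen_inter_preimage hU₁ isOpen_ball, fun z hz => ?_, ?_, ?_, ?_⟩
  · have hz1 : ‖z‖ ≤ 1 := by simpa using hz
    refine ⟨⟨hUc hz, one_sub_conj_mul_ne_zero hp hz1⟩, ?_⟩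
    have h1 : ‖g z‖ < 1 := mem_ball_zero_iff.1 (hgD (hUc hz))
    rw [mem_preimage, mem_ball_zero_iff, norm_smul]
    have h2 := norm_mobius_le_one hp hz1
    nlinarith [norm_nonneg (g z), norm_nonneg (mobius (lam 0) z)]
  · exact (differentiableOn_ballAut ha).comp (hk.mono inter_subset_left) fun z hz => hz.2
  · exact (mapsTo_ballAut ha).comp fun z hz => hz.2
  · intro j
    refine Fin.cases (by simp) (fun i => ?_) j
    have h1 := hgi i
    simp only [Fin.tail] at h1
    simp only [h1]
    rw [← hφ _ (hlam _), ballAut_ballAut ha (mem_ball_zero_iff.1 (hfD (hlam _))).le]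

lemma not_weakExtremalFor_one {φ : ℂ → V} {lam : Fin 1 → ℂ} (hlam : lam 0 ∈ unitDisc)
    (hφ : MapsTo φ unitDisc (ball 0 1)) : ¬ WeakExtremalFor (ball 0 1) φ lam := fun h =>
  h ⟨univ, fun _ => φ (lam 0), isOpen_univ, subset_univ _, differentiableOn_const _,
    fun _ _ => hφ hlam, fun j => by rw [Subsingleton.elim j 0]⟩

end SchurAlgorithm

section Geodesic

variable {V : Type*} [NormedAddCommGroup V] [InnerProductSpace ℂ V]

/-- If `Φ ∘ f` is a geodesic of `D'` and `Φ : D → D'` is holomorphic, then `f` is a geodesic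
of `D`. -/
lemma IsGeodesic.of_comp {W W' : Type*} [NormedAddCommGroup W] [NormedSpace ℂ W]
    [NormedAddCommGroup W'] [NormedSpace ℂ W'] {D : Set W} {D' : Set W'} {f : ℂ → W} {Φ : W → W'}
    {m : ℕ} (hΦ : DifferentiableOn ℂ Φ D) (hΦD : MapsTo Φ D D') (h : IsGeodesic D' (Φ ∘ f) m) :
    IsGeodesic D f m := by
  obtain ⟨F, hF, hFD, k, hk, hkm, hB⟩ := h
  exact ⟨F ∘ Φ, hF.comp hΦ hΦD, hFD.comp hΦD, k, hk, hkm, hB⟩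

lemma IsGeodesic.congr {W : Type*} [NormedAddCommGroup W] [NormedSpace ℂ W]
    {D : Set W} {f g : ℂ → W} {m : ℕ} (hfg : EqOn f g unitDisc) (h : IsGeodesic D g m) :
    IsGeodesic D f m := by
  obtain ⟨F, hF, hFD, k, hk, hkm, ζ, α, hζ, hα, hB⟩ := h
  exact ⟨F, hF, hFD, k, hk, hkm, ζ, α, hζ, hα, fun z hz => by simp only [hfg hz]; exact hB z hz⟩

/-- The disc through the origin in the direction of a unit vector is a geodesic. -/
lemma isGeodesic_smul_const {v : V} (hv : ‖v‖ = 1) :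
    IsGeodesic (ball 0 1) (fun z => z • v) 3 := by
  refine ⟨fun x => inner ℂ v x, (innerSL ℂ v).differentiable.differentiableOn, fun x hx => ?_,
    1, le_rfl, by norm_num, 1, fun _ => 0, by simp, by simp, fun z _ => ?_⟩
  · rw [mem_ball_zero_iff] at hx
    have := norm_inner_le_norm (𝕜 := ℂ) v x
    rw [hv, one_mul] at this
    exact mem_unitDisc.2 (this.trans_lt hx)
  · simp [inner_self_eq_norm_sq_to_K, hv]

lemma norm_inner_sq_add_norm_inner_sq_le {e₁ e₂ : V} (h₁ : ‖e₁‖ = 1) (h₂ : ‖e₂‖ = 1 ∨ e₂ = 0)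
    (h₁₂ : inner ℂ e₁ e₂ = 0) (x : V) :
    ‖inner ℂ e₁ x‖ ^ 2 + ‖inner ℂ e₂ x‖ ^ 2 ≤ ‖x‖ ^ 2 := by
  have h₂₁ : inner ℂ e₂ e₁ = 0 := inner_eq_zero_symm.1 h₁₂
  have h₂₂ : inner ℂ e₂ e₂ * inner ℂ e₂ x = inner ℂ e₂ x := by
    rcases h₂ with h | h <;> simp [inner_self_eq_norm_sq_to_K, h]
  have h₁₁ : inner ℂ e₁ e₁ = 1 := by simp [inner_self_eq_norm_sq_to_K, h₁]
  set y := x - inner ℂ e₁ x • e₁ - inner ℂ e₂ x • e₂ with hy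
  have key : inner ℂ y y = inner ℂ x x - inner ℂ e₁ x * (starRingEnd ℂ) (inner ℂ e₁ x)
      - inner ℂ e₂ x * (starRingEnd ℂ) (inner ℂ e₂ x) := by
    simp only [hy, inner_sub_left, inner_sub_right, inner_smul_left, inner_smul_right, h₁₁, h₁₂,
      h₂₁, inner_conj_symm]
    linear_combination (inner ℂ x e₂) * h₂₂
  simp only [inner_self_eq_ofReal_norm_sq, mul_conj, normSq_eq_norm_sq] at key
  have : ‖y‖ ^ 2 = ‖x‖ ^ 2 - ‖inner ℂ e₁ x‖ ^ 2 - ‖inner ℂ e₂ x‖ ^ 2 := by exact_mod_cast key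
  nlinarith [sq_nonneg ‖y‖]

/-- A disc with the Gram kernel of `(√(1 - A) m, √A m²)`, where `m` is a Möbius function, is a
3-geodesic. -/
lemma isGeodesic_of_inner_eq {f : ℂ → V} {s : ℂ} {A : ℝ} (hs : ‖s‖ < 1) (hA : 0 < A) (hA1 : A ≤ 1)
    (hk : ∀ z ∈ unitDisc, ∀ w ∈ unitDisc, inner ℂ (f w) (f z) =
      (1 - A) * (mobius s z * (starRingEnd ℂ) (mobius s w)) +
        A * (mobius s z * (starRingEnd ℂ) (mobius s w)) ^ 2) :
    IsGeodesic (ball 0 1) f 3 := by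
  have hs' : ‖-s‖ < 1 := by simpa using hs
  have hms : ∀ t : ℂ, ‖t‖ < 1 → mobius s (mobius (-s) t) = t := fun t ht => by
    simpa using mobius_neg_mobius hs' ht.le
  have hmd : ∀ t : ℂ, ‖t‖ < 1 → mobius (-s) t ∈ unitDisc := fun t ht =>
    mem_unitDisc.2 (norm_mobius_lt_one hs' ht)
  have hhalf : ‖(1 / 2 : ℂ)‖ < 1 := by norm_num
  have hhalf' : ‖(-1 / 2 : ℂ)‖ < 1 := by norm_num
  obtain ⟨a, ha, haA⟩ : ∃ a : ℝ, 0 < a ∧ a ^ 2 = A := ⟨√A, Real.sqrt_pos.2 hA, Real.sq_sqrt hA.le⟩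
  obtain ⟨b, hb, hbA⟩ : ∃ b : ℝ, 0 ≤ b ∧ b ^ 2 = 1 - A :=
    ⟨√(1 - A), Real.sqrt_nonneg _, Real.sq_sqrt (by linarith)⟩
  have hac : (a : ℂ) ≠ 0 := by exact_mod_cast ha.ne'
  have haA' : (A : ℂ) = a ^ 2 := by exact_mod_cast haA.symm
  have hbA' : (1 - A : ℂ) = b ^ 2 := by exact_mod_cast hbA.symm
  set x₁ := f (mobius (-s) (1 / 2)) with hx₁
  set x₂ := f (mobius (-s) (-1 / 2)) with hx₂
  set e₁ : V := (2 / a : ℂ) • (x₁ + x₂) with he₁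
  set e₂ : V := (b⁻¹ : ℂ) • (x₁ - x₂) with he₂
  have hi₁ : ∀ z ∈ unitDisc, inner ℂ x₁ (f z) = b ^ 2 * mobius s z / 2 +
      a ^ 2 * mobius s z ^ 2 / 4 := fun z hz => by
    rw [hx₁, hk z hz _ (hmd _ hhalf), hms _ hhalf, hbA', haA']
    simp only [map_div₀, map_one, map_ofNat]
    ring
  have hi₂ : ∀ z ∈ unitDisc, inner ℂ x₂ (f z) = - b ^ 2 * mobius s z / 2 +
      a ^ 2 * mobius s z ^ 2 / 4 := fun z hz => by
    rw [hx₂, hk z hz _ (hmd _ hhalf'), hms _ hhalf', hbA', haA']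
    simp only [map_div₀, map_one, map_ofNat, map_neg]
    ring
  have hf₁ : ∀ z ∈ unitDisc, inner ℂ e₁ (f z) = a * mobius s z ^ 2 := fun z hz => by
    simp only [he₁, inner_smul_left, inner_add_left, hi₁ z hz, hi₂ z hz, map_div₀, map_ofNat,
      conj_ofReal]
    field_simp
    ring
  have hf₂ : ∀ z ∈ unitDisc, inner ℂ e₂ (f z) = b * mobius s z := fun z hz => by
    simp only [he₂, inner_smul_left, inner_sub_left, hi₁ z hz, hi₂ z hz, map_inv₀, conj_ofReal]
    rcases eq_or_ne b 0 with h | h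
    · simp [h]
    · have : (b : ℂ) ≠ 0 := by exact_mod_cast h
      field_simp
      ring
  have h₁₁ : inner ℂ e₁ e₁ = 1 := by
    conv_lhs => rw [he₁, inner_smul_right, inner_add_right]
    rw [hf₁ _ (hmd _ hhalf), hf₁ _ (hmd _ hhalf'), hms _ hhalf, hms _ hhalf']
    field_simp
    norm_num
  have h₁₂ : inner ℂ e₁ e₂ = 0 := by
    conv_lhs => rw [he₂, inner_smul_right, inner_sub_right]
    rw [hf₁ _ (hmd _ hhalf), hf₁ _ (hmd _ hhalf'), hms _ hhalf, hms _ hhalf']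
    ring
  have hn₁ : ‖e₁‖ = 1 := by
    rw [inner_self_eq_ofReal_norm_sq] at h₁₁
    have : ‖e₁‖ ^ 2 = 1 := by exact_mod_cast h₁₁
    nlinarith [norm_nonneg e₁]
  have hn₂ : ‖e₂‖ = 1 ∨ e₂ = 0 := by
    rcases eq_or_ne b 0 with h | h
    · right
      simp [he₂, h]
    · left
      have hbc : (b : ℂ) ≠ 0 := by exact_mod_cast h
      have h₂₂ : inner ℂ e₂ e₂ = 1 := by
        conv_lhs => rw [he₂, inner_smul_right, inner_sub_right]
        rw [hf₂ _ (hmd _ hhalf), hf₂ _ (hmd _ hhalf'), hms _ hhalf, hms _ hhalf']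
        field_simp
        norm_num
      rw [inner_self_eq_ofReal_norm_sq] at h₂₂
      have : ‖e₂‖ ^ 2 = 1 := by exact_mod_cast h₂₂
      nlinarith [norm_nonneg e₂]
  have hpos : (0 : ℝ) < 1 + a ^ 2 := by positivity
  have hposc : (1 + a ^ 2 : ℂ) ≠ 0 := by exact_mod_cast hpos.ne'
  refine ⟨fun x => (2 * a * inner ℂ e₁ x + inner ℂ e₂ x ^ 2) / (1 + a ^ 2), ?_, fun x hx => ?_,
    2, by norm_num, by norm_num, 1, fun _ => s, by simp, fun _ => hs, fun z hz => ?_⟩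
  · have hd : ∀ e : V, Differentiable ℂ fun x : V => inner ℂ e x := fun e =>
      (innerSL ℂ e).differentiable
    have h : Differentiable ℂ fun x : V =>
        (2 * a * inner ℂ e₁ x + inner ℂ e₂ x ^ 2) * ((1 + a ^ 2 : ℂ))⁻¹ :=
      (((hd e₁).const_mul _).add ((hd e₂).pow 2)).mul_const _
    simpa only [div_eq_mul_inv] using h.differentiableOn
  · rw [mem_ball_zero_iff] at hx
    have hB := norm_inner_sq_add_norm_inner_sq_le hn₁ hn₂ h₁₂ x
    have hden : ‖(1 + a ^ 2 : ℂ)‖ = 1 + a ^ 2 := by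
      rw [show (1 + a ^ 2 : ℂ) = ((1 + a ^ 2 : ℝ) : ℂ) by push_cast; ring, norm_real,
        Real.norm_of_nonneg hpos.le]
    rw [mem_unitDisc, norm_div, hden, div_lt_one hpos]
    calc ‖2 * (a : ℂ) * inner ℂ e₁ x + inner ℂ e₂ x ^ 2‖
        ≤ ‖2 * (a : ℂ) * inner ℂ e₁ x‖ + ‖inner ℂ e₂ x ^ 2‖ := norm_add_le _ _
      _ = 2 * a * ‖inner ℂ e₁ x‖ + ‖inner ℂ e₂ x‖ ^ 2 := by
        simp [abs_of_pos ha]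
      _ < 1 + a ^ 2 := by
        nlinarith [sq_nonneg (a - ‖inner ℂ e₁ x‖), norm_nonneg x]
  · simp only [hf₁ z hz, hf₂ z hz, Fin.prod_univ_two, one_mul]
    have : (b : ℂ) ^ 2 = 1 - a ^ 2 := by rw [← hbA', haA']
    rw [div_eq_iff hposc]
    linear_combination mobius s z ^ 2 * this

/-- The parameter `τ` locating the center `τ β` of the Hermitian form `|1 - β̄ z|² + C |z|²`. -/
lemma exists_center_parameters {B C : ℝ} (hB : 0 ≤ B) (hB1 : B < 1) (hC : 0 < C)
    (hCB : C ≤ 1 - B) :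
    ∃ τ A κ : ℝ, 0 < τ ∧ τ < 1 ∧ 0 < A ∧ A ≤ 1 ∧ 0 < κ ∧ κ * (1 + A * τ ^ 2 * B) = 1 ∧
      κ * τ * (1 + A) = 1 ∧ κ * (τ ^ 2 * B + A) = B + C := by
  obtain ⟨τ, ⟨hτ0, hτ1⟩, hτ⟩ : ∃ τ ∈ Icc (0 : ℝ) 1, B * τ ^ 2 - (1 + B + C) * τ + 1 = 0 := by
    have hcont : ContinuousOn (fun τ : ℝ => B * τ ^ 2 - (1 + B + C) * τ + 1) (Icc 0 1) := by
      fun_prop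
    obtain ⟨τ, h, h'⟩ := intermediate_value_Icc' zero_le_one hcont
      (show (0 : ℝ) ∈ Icc _ _ from ⟨by norm_num; linarith, by norm_num⟩)
    exact ⟨τ, h, h'⟩
  have hτ0' : 0 < τ := lt_of_le_of_ne hτ0 (by rintro rfl; norm_num at hτ)
  have hτ1' : τ < 1 := lt_of_le_of_ne hτ1 (by rintro rfl; linarith)
  have hτB : 0 < 1 - τ * B := by nlinarith
  have hd : 0 < τ * (1 - τ * B) := mul_pos hτ0' hτB
  obtain ⟨A, hA⟩ : ∃ A, A * (τ * (1 - τ * B)) = 1 - τ :=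
    ⟨(1 - τ) / (τ * (1 - τ * B)), div_mul_cancel₀ _ hd.ne'⟩
  have hA0 : 0 < A := by
    by_contra! h
    nlinarith
  have hA1 : A ≤ 1 := by
    by_contra! h
    nlinarith [mul_nonneg hτ0 (sub_nonneg.2 hCB)]
  have hκ : (τ * (1 + A))⁻¹ * (τ * (1 + A)) = 1 := inv_mul_cancel₀ (by positivity)
  refine ⟨τ, A, (τ * (1 + A))⁻¹, hτ0', hτ1', hA0, hA1, by positivity, ?_, ?_, ?_⟩
  · rw [show 1 + A * τ ^ 2 * B = τ * (1 + A) by linear_combination -hA, hκ]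
  · rw [mul_assoc, hκ]
  · rw [inv_mul_eq_iff_eq_mul₀ (by positivity)]
    have : (τ * (1 - τ * B)) * (τ ^ 2 * B + A - τ * (1 + A) * (B + C)) = 0 := by
      linear_combination (1 - τ * (B + C)) * hA + (1 - τ ^ 2 * B) * hτ
    have h := (mul_eq_zero.1 this).resolve_left hd.ne'
    linarith

/-- A disc with kernel `1 + C z w̄ / ((1 - β̄ z)(1 - β w̄))` is a 3-geodesic. -/
lemma isGeodesic_of_kernel_eq {f : ℂ → V} {β : ℂ} {C : ℝ} (hfD : MapsTo f unitDisc (ball 0 1))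
    (hβ : ‖β‖ < 1) (hC : 0 < C) (hCβ : C ≤ 1 - ‖β‖ ^ 2)
    (hk : ∀ z ∈ unitDisc, ∀ w ∈ unitDisc, 1 - inner ℂ (f w) (f z) =
      (1 - z * (starRingEnd ℂ) w) * (1 + C * (z * (starRingEnd ℂ) w) /
        ((1 - (starRingEnd ℂ) β * z) * (1 - β * (starRingEnd ℂ) w)))) :
    IsGeodesic (ball 0 1) f 3 := by
  obtain ⟨τ, A, κ, hτ0, hτ1, hA0, hA1, hκ, e₁, e₂, e₃⟩ :=
    exists_center_parameters (sq_nonneg ‖β‖) (by nlinarith [norm_nonneg β]) hC hCβ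
  have e₁' : (κ : ℂ) * (1 + A * τ ^ 2 * (β * (starRingEnd ℂ) β)) = 1 := by
    rw [mul_conj, normSq_eq_norm_sq]
    exact_mod_cast e₁
  have e₂' : (κ : ℂ) * τ * (1 + A) = 1 := by exact_mod_cast e₂
  have e₃' : (κ : ℂ) * (τ ^ 2 * (β * (starRingEnd ℂ) β) + A) = β * (starRingEnd ℂ) β + C := by
    rw [mul_conj, normSq_eq_norm_sq]
    exact_mod_cast e₃
  set s : ℂ := τ * β with hs_def
  have hs : ‖s‖ < 1 := by
    rw [hs_def, norm_mul, norm_real, Real.norm_of_nonneg hτ0.le]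
    nlinarith [norm_nonneg β]
  have hsD : s ∈ unitDisc := mem_unitDisc.2 hs
  have hsc : (starRingEnd ℂ) s = τ * (starRingEnd ℂ) β := by simp [hs_def]
  have ha : ‖f s‖ < 1 := mem_ball_zero_iff.1 (hfD hsD)
  set c : ℂ := (1 - inner ℂ (f s) (f s)) * κ / (1 - s * (starRingEnd ℂ) s) with hc
  set g : ℂ → ℂ := fun z => (1 - (starRingEnd ℂ) s * z) ^ 2 /
    ((1 - (starRingEnd ℂ) β * z) * (1 - inner ℂ (f s) (f z))) with hg
  set g' : ℂ → ℂ := fun w => (1 - s * (starRingEnd ℂ) w) ^ 2 /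
    ((1 - β * (starRingEnd ℂ) w) * (1 - inner ℂ (f w) (f s))) with hg'
  have hmain : ∀ z ∈ unitDisc, ∀ w ∈ unitDisc,
      1 - inner ℂ (ballAut (f s) (f w)) (ballAut (f s) (f z)) =
        c * g z * g' w * ((1 - mobius s z * (starRingEnd ℂ) (mobius s w)) *
          (1 + A * (mobius s z * (starRingEnd ℂ) (mobius s w)))) := by
    intro z hz w hw
    have hz1 := mem_unitDisc.1 hz
    have hw1 := mem_unitDisc.1 hw
    have hfz : ‖f z‖ < 1 := mem_ball_zero_iff.1 (hfD hz)
    have hfw : ‖f w‖ < 1 := mem_ball_zero_iff.1 (hfD hw)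
    have n₁ := one_sub_conj_mul_ne_zero hs hz1.le
    have n₂ : 1 - s * (starRingEnd ℂ) w ≠ 0 := by
      simpa using (map_ne_zero (starRingEnd ℂ)).2 (one_sub_conj_mul_ne_zero hs hw1.le)
    have n₃ := one_sub_conj_mul_ne_zero hβ hz1.le
    have n₄ : 1 - β * (starRingEnd ℂ) w ≠ 0 := by
      simpa using (map_ne_zero (starRingEnd ℂ)).2 (one_sub_conj_mul_ne_zero hβ hw1.le)
    have n₅ := one_sub_inner_ne_zero ha hfz.le
    have n₆ := one_sub_inner_ne_zero' ha hfw.le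
    have n₇ : 1 - s * (starRingEnd ℂ) s ≠ 0 := by
      simpa [mul_comm] using one_sub_conj_mul_ne_zero hs hs.le
    have hH : (1 - (starRingEnd ℂ) β * z) * (1 - β * (starRingEnd ℂ) w) +
        C * (z * (starRingEnd ℂ) w) =
        κ * ((1 - (starRingEnd ℂ) s * z) * (1 - s * (starRingEnd ℂ) w) +
          A * ((z - s) * ((starRingEnd ℂ) w - (starRingEnd ℂ) s))) := by
      rw [hsc, hs_def]
      linear_combination -e₁' + ((starRingEnd ℂ) β * z + β * (starRingEnd ℂ) w) * e₂' -
        z * (starRingEnd ℂ) w * e₃'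
    have hK : 1 - inner ℂ (f w) (f z) = (1 - z * (starRingEnd ℂ) w) *
        (κ * ((1 - (starRingEnd ℂ) s * z) * (1 - s * (starRingEnd ℂ) w) +
          A * ((z - s) * ((starRingEnd ℂ) w - (starRingEnd ℂ) s)))) /
        ((1 - (starRingEnd ℂ) β * z) * (1 - β * (starRingEnd ℂ) w)) := by
      rw [hk z hz w hw, ← hH, mul_div_assoc _ (_ + _), add_div, div_self (mul_ne_zero n₃ n₄)]
    have hM : 1 + A * (mobius s z * (starRingEnd ℂ) (mobius s w)) =
        ((1 - (starRingEnd ℂ) s * z) * (1 - s * (starRingEnd ℂ) w) +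
          A * ((z - s) * ((starRingEnd ℂ) w - (starRingEnd ℂ) s))) /
        ((1 - (starRingEnd ℂ) s * z) * (1 - s * (starRingEnd ℂ) w)) := by
      rw [add_div, div_self (mul_ne_zero n₁ n₂), mul_div_assoc]
      simp only [mobius, map_div₀, map_sub, map_mul, map_one, conj_conj, div_mul_div_comm]
    rw [ballAut_kernel ha hfz.le hfw.le, hK, mobius_kernel hs hz1.le hw1.le, hM, hc, hg, hg']
    generalize (1 - (starRingEnd ℂ) s * z) * (1 - s * (starRingEnd ℂ) w) +
          A * ((z - s) * ((starRingEnd ℂ) w - (starRingEnd ℂ) s)) = T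
    dsimp only
    generalize 1 - (starRingEnd ℂ) s * z = a₁ at *
    generalize 1 - s * (starRingEnd ℂ) w = a₂ at *
    generalize 1 - (starRingEnd ℂ) β * z = a₃ at *
    generalize 1 - β * (starRingEnd ℂ) w = a₄ at *
    generalize 1 - inner ℂ (f s) (f z) = a₅ at *
    generalize 1 - inner ℂ (f w) (f s) = a₆ at *
    generalize 1 - s * (starRingEnd ℂ) s = a₇ at *
    field_simp
  have hone : ∀ z ∈ unitDisc, ∀ w ∈ unitDisc, c * g z * g' w = 1 := by
    have hz : ∀ z ∈ unitDisc, c * g z * g' s = 1 := fun z hz => by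
      simpa [ballAut_self ha] using (hmain z hz s hsD).symm
    have hw : ∀ w ∈ unitDisc, c * g s * g' w = 1 := fun w hw => by
      simpa [ballAut_self ha] using (hmain s hsD w hw).symm
    intro z hz' w hw'
    calc c * g z * g' w = (c * g z * g' w) * (c * g s * g' s) := by rw [hz s hsD, mul_one]
      _ = (c * g z * g' s) * (c * g s * g' w) := by ring
      _ = 1 := by rw [hz z hz', hw w hw', mul_one]
  refine IsGeodesic.of_comp (Φ := ballAut (f s)) (differentiableOn_ballAut ha) (mapsTo_ballAut ha)
    (isGeodesic_of_inner_eq hs hA0 hA1 fun z hz w hw => ?_)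
  have := hmain z hz w hw
  rw [hone z hz w hw] at this
  simp only [Function.comp_apply]
  linear_combination -this

/-- The kernel of a disc that an automorphism of the ball maps to `z ↦ mobius p z • v`. -/
lemma exists_kernel_of_ballAut_eq {φ : ℂ → V} {v : V} {p : ℂ} (hp : p ∈ unitDisc)
    (hφD : MapsTo φ unitDisc (ball 0 1)) (hv : ‖v‖ = 1)
    (hφ : ∀ z ∈ unitDisc, ballAut (φ p) (φ z) = mobius p z • v) :
    ∃ (β : ℂ) (C : ℝ), ‖β‖ < 1 ∧ 0 < C ∧ C ≤ 1 - ‖β‖ ^ 2 ∧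
      ∀ z ∈ unitDisc, ∀ w ∈ unitDisc, 1 - inner ℂ (φ w) (φ z) =
        C * (1 - z * (starRingEnd ℂ) w) /
          ((1 - (starRingEnd ℂ) β * z) * (1 - β * (starRingEnd ℂ) w)) := by
  have hp1 : ‖p‖ < 1 := mem_unitDisc.1 hp
  have ha : ‖φ p‖ < 1 := mem_ball_zero_iff.1 (hφD hp)
  set a := φ p
  set t : ℂ := inner ℂ a v with ht
  have ht1 : ‖t‖ < 1 := by
    have := norm_inner_le_norm (𝕜 := ℂ) a v
    rw [hv, mul_one] at this
    exact this.trans_lt ha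
  have hpt : 1 + p * t ≠ 0 := by
    have := one_sub_conj_mul_ne_zero (a := -(starRingEnd ℂ) p) (z := t) (by simpa using hp1) ht1.le
    simpa using this
  set q : ℂ := mobius (-(starRingEnd ℂ) p) t with hq
  have hq1 : ‖q‖ < 1 := norm_mobius_lt_one (by simpa using hp1) ht1
  have hqt : q * (1 + p * t) = t + (starRingEnd ℂ) p := by
    simp only [hq, mobius, map_neg, conj_conj]
    rw [neg_mul, sub_neg_eq_add, sub_neg_eq_add, div_mul_cancel₀ _ hpt]
  have hpt' : 1 + (starRingEnd ℂ) p * (starRingEnd ℂ) t ≠ 0 := by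
    simpa using (map_ne_zero (starRingEnd ℂ)).2 hpt
  set C : ℝ := (1 - ‖a‖ ^ 2) * (1 - ‖p‖ ^ 2) / ‖1 + p * t‖ ^ 2 with hC
  have hCc : (C : ℂ) = (1 - inner ℂ a a) * (1 - p * (starRingEnd ℂ) p) /
      ((1 + p * t) * (1 + (starRingEnd ℂ) p * (starRingEnd ℂ) t)) := by
    rw [show (1 + (starRingEnd ℂ) p * (starRingEnd ℂ) t) = (starRingEnd ℂ) (1 + p * t) by simp,
      mul_conj, mul_conj, normSq_eq_norm_sq, normSq_eq_norm_sq, inner_self_eq_ofReal_norm_sq, hC]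
    push_cast
    rfl
  have hC0 : 0 < C := by
    have h1 : 0 < 1 - ‖a‖ ^ 2 := by nlinarith [norm_nonneg a]
    have h2 : 0 < 1 - ‖p‖ ^ 2 := by nlinarith [norm_nonneg p]
    have h3 : 0 < ‖1 + p * t‖ := norm_pos_iff.2 hpt
    positivity
  have hker : ∀ z ∈ unitDisc, ∀ w ∈ unitDisc, 1 - inner ℂ (φ w) (φ z) =
        C * (1 - z * (starRingEnd ℂ) w) /
          ((1 - (starRingEnd ℂ) ((starRingEnd ℂ) q) * z) *
            (1 - (starRingEnd ℂ) q * (starRingEnd ℂ) w)) := by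
    intro z hz w hw
    have hz1 := mem_unitDisc.1 hz
    have hw1 := mem_unitDisc.1 hw
    have hmv : ∀ z ∈ unitDisc, ‖mobius p z • v‖ < 1 := fun z hz => by
      rw [norm_smul, hv, mul_one]
      exact norm_mobius_lt_one hp1 (mem_unitDisc.1 hz)
    have hinv : ∀ z ∈ unitDisc, φ z = ballAut a (mobius p z • v) := fun z hz => by
      rw [← hφ z hz, ballAut_ballAut ha (mem_ball_zero_iff.1 (hφD hz)).le]
    have m₁ := one_sub_inner_ne_zero ha (hmv z hz).le
    have m₂ := one_sub_inner_ne_zero' ha (hmv w hw).le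
    rw [hinv z hz, hinv w hw, ballAut_kernel ha (hmv z hz).le (hmv w hw).le]
    have hvv : inner ℂ v v = (1 : ℂ) := by simp [inner_self_eq_norm_sq_to_K, hv]
    have htv : inner ℂ v a = (starRingEnd ℂ) t := by rw [ht, inner_conj_symm]
    simp only [inner_smul_left, inner_smul_right, hvv, htv, ← ht] at m₁ m₂ ⊢
    have n₁ := one_sub_conj_mul_ne_zero hp1 hz1.le
    have n₂ : 1 - p * (starRingEnd ℂ) w ≠ 0 := by
      simpa using (map_ne_zero (starRingEnd ℂ)).2 (one_sub_conj_mul_ne_zero hp1 hw1.le)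
    have d₁ : (1 - mobius p z * t) =
        (1 + p * t) * (1 - q * z) / (1 - (starRingEnd ℂ) p * z) := by
      rw [eq_div_iff n₁, sub_mul, mul_right_comm, mobius, div_mul_cancel₀ _ n₁]
      linear_combination z * hqt
    have d₂ : (1 - (starRingEnd ℂ) (mobius p w) * (starRingEnd ℂ) t) =
        (1 + (starRingEnd ℂ) p * (starRingEnd ℂ) t) *
          (1 - (starRingEnd ℂ) q * (starRingEnd ℂ) w) / (1 - p * (starRingEnd ℂ) w) := by
      simpa using congrArg (starRingEnd ℂ) (show (1 - mobius p w * t) =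
        (1 + p * t) * (1 - q * w) / (1 - (starRingEnd ℂ) p * w) by
          have n := one_sub_conj_mul_ne_zero hp1 hw1.le
          rw [eq_div_iff n, sub_mul, mul_right_comm, mobius, div_mul_cancel₀ _ n]
          linear_combination w * hqt)
    have d₃ : 1 - q * z ≠ 0 := by
      simpa using one_sub_conj_mul_ne_zero (a := (starRingEnd ℂ) q) (by simpa using hq1) hz1.le
    have d₄ : 1 - (starRingEnd ℂ) q * (starRingEnd ℂ) w ≠ 0 :=
      one_sub_conj_mul_ne_zero hq1 (by simpa using hw1.le)
    have hmm := mobius_kernel hp1 hz1.le hw1.le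
    rw [d₁, d₂, hCc, conj_conj, show 1 - mobius p z * ((starRingEnd ℂ) (mobius p w) * 1) =
      1 - mobius p z * (starRingEnd ℂ) (mobius p w) by ring, hmm]
    generalize 1 - (starRingEnd ℂ) p * z = a₁ at *
    generalize 1 - p * (starRingEnd ℂ) w = a₂ at *
    generalize 1 - q * z = a₃ at *
    generalize 1 - (starRingEnd ℂ) q * (starRingEnd ℂ) w = a₄ at *
    generalize 1 + p * t = a₅ at *
    generalize 1 + (starRingEnd ℂ) p * (starRingEnd ℂ) t = a₆ at *
    field_simp
  have hβ : ‖(starRingEnd ℂ) q‖ < 1 := by simpa using hq1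
  refine ⟨(starRingEnd ℂ) q, C, hβ, hC0, ?_, hker⟩
  generalize (starRingEnd ℂ) q = β at *
  have hβ' : 0 < 1 - ‖β‖ ^ 2 := by nlinarith [norm_nonneg β]
  have h := hker β (mem_unitDisc.2 hβ) β (mem_unitDisc.2 hβ)
  rw [mul_comm ((starRingEnd ℂ) β), mul_conj, normSq_eq_norm_sq, inner_self_eq_ofReal_norm_sq] at h
  have h' : 1 - ‖φ β‖ ^ 2 = C * (1 - ‖β‖ ^ 2) / ((1 - ‖β‖ ^ 2) * (1 - ‖β‖ ^ 2)) := by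
    exact_mod_cast h
  rw [mul_div_mul_right _ _ hβ'.ne'] at h'
  have : C / (1 - ‖β‖ ^ 2) ≤ 1 := by rw [← h']; nlinarith [sq_nonneg ‖φ β‖]
  rwa [div_le_one hβ'] at this

/-- Every 3-extremal of the unit ball of a complex Hilbert space is a 3-geodesic. -/
lemma isGeodesic_of_isExtremal_ball [CompleteSpace V] {f : ℂ → V}
    (hf : DifferentiableOn ℂ f unitDisc) (hfD : MapsTo f unitDisc (ball 0 1))
    (hext : IsExtremal (ball 0 1) f 3) : IsGeodesic (ball 0 1) f 3 := by
  set lam : Fin 3 → ℂ := ![0, 1 / 2, 1 / 3] with hlam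
  have hmem : ∀ j, lam j ∈ unitDisc := by
    intro j
    rw [mem_unitDisc]
    fin_cases j <;> norm_num [hlam]
  have hinj : Function.Injective lam := by
    intro i j hij
    fin_cases i <;> fin_cases j <;> simp_all
  have h3 := hext lam hinj hmem
  have ha : ‖f 0‖ < 1 := mem_ball_zero_iff.1 (hfD (hmem 0))
  obtain ⟨φ, hφd, hφ, hfφ⟩ := exists_schur_transform (hmem 0) hf hfD
  have h2 := h3.schur_transform hmem hfD hfφ
  refine IsGeodesic.of_comp (Φ := ballAut (f 0)) (differentiableOn_ballAut ha)
    (mapsTo_ballAut ha) ?_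
  have hfφ' : ∀ z ∈ unitDisc, (ballAut (f 0) ∘ f) z = z • φ z := fun z hz => by
    simpa [hlam] using hfφ z hz
  rcases hφ with ⟨v, hv, hφv⟩ | hφD
  · exact (isGeodesic_smul_const hv).congr fun z hz => by rw [hfφ' z hz, hφv z hz]
  have hmem' : ∀ j, Fin.tail lam j ∈ unitDisc := fun j => hmem _
  obtain ⟨ψ, -, hψ, hφψ⟩ := exists_schur_transform (hmem' 0) hφd hφD
  have h1 := h2.schur_transform hmem' hφD hφψ
  rcases hψ with ⟨v, hv, hψv⟩ | hψD
  swap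
  · exact absurd h1 (not_weakExtremalFor_one (hmem' _) hψD)
  obtain ⟨β, C, hβ, hC, hCβ, hker⟩ := exists_kernel_of_ballAut_eq (hmem' 0) hφD hv
    fun z hz => by rw [hφψ z hz, hψv z hz]
  refine isGeodesic_of_kernel_eq ((mapsTo_ballAut ha).comp hfD) hβ hC hCβ fun z hz w hw => ?_
  rw [hfφ' z hz, hfφ' w hw, inner_smul_left, inner_smul_right]
  have h := hker z hz w hw
  rw [mul_div_assoc] at h
  rw [mul_div_assoc]
  linear_combination z * (starRingEnd ℂ) w * h

end Geodesic

section EuclideanBall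

lemma toLp_mem_ball_iff {n : ℕ} (x : Fin n → ℂ) :
    (EuclideanSpace.equiv (Fin n) ℂ).symm x ∈ ball (0 : EuclideanSpace ℂ (Fin n)) 1 ↔
      x ∈ euclideanBall n := by
  have h : ‖(EuclideanSpace.equiv (Fin n) ℂ).symm x‖ ^ 2 = ∑ j, ‖x j‖ ^ 2 :=
    EuclideanSpace.norm_sq_eq _
  rw [mem_ball_zero_iff, euclideanBall]
  change _ ↔ ∑ j, ‖x j‖ ^ 2 < 1
  rw [← h, sq_lt_one_iff₀ (norm_nonneg _)]

lemma WeakExtremalFor.comp_equiv {W W' : Type*} [NormedAddCommGroup W] [NormedSpace ℂ W]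
    [NormedAddCommGroup W'] [NormedSpace ℂ W'] {D : Set W} {D' : Set W'} {f : ℂ → W} {m : ℕ}
    {lam : Fin m → ℂ} (e : W ≃L[ℂ] W') (he : ∀ x, e x ∈ D' ↔ x ∈ D)
    (h : WeakExtremalFor D f lam) : WeakExtremalFor D' (e ∘ f) lam := by
  rintro ⟨U, g, hU, hUc, hg, hgD, hgi⟩
  refine h ⟨U, e.symm ∘ g, hU, hUc, e.symm.differentiable.comp_differentiableOn hg,
    fun z hz => ?_, fun j => ?_⟩
  · rw [← he]
    simpa using hgD hz
  · simp [hgi j]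

end EuclideanBall

/-- Every 3-extremal of the Euclidean unit ball `𝔹_n` is a
3-geodesic. -/
theorem three_extremal_of_ball_is_three_geodesic {n : ℕ}
    (f : ℂ → (Fin n → ℂ))
    (hf : DifferentiableOn ℂ f unitDisc)
    (hfD : Set.MapsTo f unitDisc (euclideanBall n))
    (hext : IsExtremal (euclideanBall n) f 3) :
    IsGeodesic (euclideanBall n) f 3 := by
  set e := (EuclideanSpace.equiv (Fin n) ℂ).symm
  have he : MapsTo e (euclideanBall n) (ball 0 1) := fun x hx => (toLp_mem_ball_iff x).2 hx
  refine IsGeodesic.of_comp (Φ := e) e.differentiable.differentiableOn he ?_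
  exact isGeodesic_of_isExtremal_ball (e.differentiable.comp_differentiableOn hf) (he.comp hfD)
    fun lam hlam hmem => (hext lam hlam hmem).comp_equiv e toLp_mem_ball_iff
end
end

section
/- Let m ≥ 3 be an integer and 0 < a < 1. The map f(λ) := (a·λ^{m−2}, (1−a)·λ^{m−1}) maps 𝔻 into E(1/2,1/2) = {z ∈ ℂ² : |z₁| + |z₂| < 1}, is an m-extremal of E(1/2,1/2), but is not an m-geodesic of E(1/2,1/2). -/
open Complex Metric Set Filter

noncomputable section

variable {E : Type*} [NormedAddCommGroup E] [NormedSpace ℂ E]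

open scoped Topology ComplexConjugate Asymptotics

lemma re_eq_zero_on_sphere_of_re_nonpos {u : ℂ → ℂ}
    (hu : DifferentiableOn ℂ u (closedBall 0 1)) (h0 : u 0 = 0)
    (hre : ∀ z, ‖z‖ = 1 → (u z).re ≤ 0) {z : ℂ} (hz : ‖z‖ = 1) : (u z).re = 0 := by
  have hd : DiffContOnCl ℂ (fun w => exp (u w)) (ball (0 : ℂ) 1) :=
    (hu.cexp).diffContOnCl_ball subset_rfl
  have hle : ∀ w ∈ closure (ball (0 : ℂ) 1), ‖exp (u w)‖ ≤ 1 := fun w hw =>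
    norm_le_of_forall_mem_frontier_norm_le isBounded_ball hd (fun v hv => by
      rw [frontier_ball _ one_ne_zero, mem_sphere_zero_iff_norm] at hv
      rw [norm_exp]
      exact Real.exp_le_one_iff.2 (hre v hv)) hw
  have hmax : IsMaxOn (norm ∘ fun w => exp (u w)) (ball (0 : ℂ) 1) 0 := fun w hw => by
    simpa [h0] using hle w (subset_closure hw)
  have h := norm_eqOn_closedBall_of_isMaxOn hd hmax (show z ∈ closedBall (0 : ℂ) 1 by simp [hz])
  simpa [h0, norm_exp] using h

lemma one_sub_conj_mul_ne_zero_s1 {α z : ℂ} (hα : ‖α‖ < 1) (hz : ‖z‖ ≤ 1) : 1 - conj α * z ≠ 0 := by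
  intro h
  have h1 : ‖conj α * z‖ = 1 := by rw [← sub_eq_zero.1 h, norm_one]
  rw [norm_mul, RCLike.norm_conj] at h1
  nlinarith [norm_nonneg α, norm_nonneg z]

lemma prod_one_sub_conj_mul_ne_zero {k : ℕ} {α : Fin k → ℂ} (hα : ∀ j, ‖α j‖ < 1) {z : ℂ}
    (hz : ‖z‖ ≤ 1) : ∏ j, (1 - conj (α j) * z) ≠ 0 :=
  Finset.prod_ne_zero_iff.2 fun j _ => one_sub_conj_mul_ne_zero_s1 (hα j) hz

lemma prod_sub_eq_pow_mul_conj {k : ℕ} (α : Fin k → ℂ) {z : ℂ} (hz : ‖z‖ = 1) :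
    ∏ j, (z - α j) = z ^ k * conj (∏ j, (1 - conj (α j) * z)) := by
  have hz' : z * conj z = 1 := by simp [mul_conj', hz]
  have hpow : z ^ k = ∏ _j : Fin k, z := by simp
  rw [map_prod, hpow, ← Finset.prod_mul_distrib]
  refine Finset.prod_congr rfl fun j _ => ?_
  simp only [map_sub, map_one, map_mul, conj_conj]
  linear_combination (α j) * hz'

/-- A holomorphic function bounded by `1` on the circle which agrees with a Blaschke product of
degree `k` to order greater than `k` at the origin is unimodular on the circle. -/
lemma norm_eq_one_of_sub_blaschke_isLittleO {B g : ℂ → ℂ} {k : ℕ} (hk : 1 ≤ k)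
    (hB : IsBlaschkeOn B k) (hg : ∀ z, ‖z‖ ≤ 1 → DifferentiableAt ℂ g z)
    (hg1 : ∀ z, ‖z‖ = 1 → ‖g z‖ ≤ 1)
    (h0 : (fun z => g z - B z) =o[𝓝 0] fun z => z ^ k) {z : ℂ} (hz : ‖z‖ = 1) : ‖g z‖ = 1 := by
  obtain ⟨ζ, α, hζ, hα, hBα⟩ := hB
  set N : ℂ → ℂ := fun z => ∏ j, (z - α j)
  set M : ℂ → ℂ := fun z => ∏ j, (1 - conj (α j) * z)
  have hN : Differentiable ℂ N := by fun_prop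
  have hM : Differentiable ℂ M := by fun_prop
  have hζ' : conj ζ * ζ = 1 := by simp [conj_mul', hζ]
  set v : ℂ → ℂ := fun z => conj ζ * (g z * M z ^ 2 - ζ * N z * M z)
  set u : ℂ → ℂ := fun z => v z / z ^ k
  have hk0 : k ≠ 0 := by omega
  have hu0 : u 0 = 0 := by simp [u, hk0]
  have hdiff : ∀ z, ‖z‖ ≤ 1 → z ≠ 0 → DifferentiableAt ℂ u z := by
    intro z hz hz0
    have := hg z hz
    have := hN z
    have := hM z
    exact DifferentiableAt.div (by fun_prop) (by fun_prop) (pow_ne_zero _ hz0)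
  have hball : ∀ᶠ z in 𝓝 (0 : ℂ), z ∈ ball (0 : ℂ) 1 := ball_mem_nhds _ one_pos
  have hv : v =o[𝓝 0] fun z => z ^ k := by
    have hb : (fun z => conj ζ * M z ^ 2) =O[𝓝 0] fun _ => (1 : ℂ) :=
      ((hM.pow 2).const_mul (conj ζ)).continuous.continuousAt.isBigO_one ℂ
    have h1 := hb.mul_isLittleO h0
    simp only [one_mul] at h1
    refine h1.congr' ?_ .rfl
    filter_upwards [hball] with w hw
    have hw' : ‖w‖ < 1 := by simpa using hw
    have hMw : M w ≠ 0 := prod_one_sub_conj_mul_ne_zero hα hw'.le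
    have : B w = ζ * (N w / M w) := by
      rw [hBα w hw]
      simp only [mobius, Finset.prod_div_distrib, N, M]
    rw [this]
    simp only [v]
    field_simp
  have hu_cont : ContinuousAt u 0 := by
    rw [ContinuousAt, hu0]
    exact hv.tendsto_div_nhds_zero
  have hu_diff : DifferentiableOn ℂ u (closedBall 0 1) := by
    intro w hw
    rw [mem_closedBall_zero_iff] at hw
    rcases eq_or_ne w 0 with rfl | hw0
    · refine (analyticAt_of_differentiable_on_punctured_nhds_of_continuousAt ?_
        hu_cont).differentiableAt.differentiableWithinAt
      filter_upwards [nhdsWithin_le_nhds hball, self_mem_nhdsWithin] with w hw hw0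
      exact hdiff w (mem_ball_zero_iff.1 hw).le hw0
    · exact (hdiff w hw hw0).differentiableWithinAt
  have hre : ∀ w, ‖w‖ = 1 → ∃ c : ℂ, ‖c‖ = ‖g w‖ * ‖M w‖ ^ 2 ∧ (u w).re = c.re - ‖M w‖ ^ 2 := by
    intro w hw
    have hw0 : w ≠ 0 := norm_ne_zero_iff.1 (by simp [hw])
    refine ⟨conj ζ * g w * M w ^ 2 / w ^ k, by simp [hw, hζ], ?_⟩
    have : u w = conj ζ * g w * M w ^ 2 / w ^ k - ((‖M w‖ ^ 2 : ℝ) : ℂ) := by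
      have h1 : N w = w ^ k * conj (M w) := prod_sub_eq_pow_mul_conj α hw
      have h2 : conj (M w) * M w = ((‖M w‖ ^ 2 : ℝ) : ℂ) := by
        rw [conj_mul']; push_cast; rfl
      rw [← h2]
      simp only [u, v, h1]
      field_simp
      linear_combination (- w ^ k * conj (M w)* M w) * hζ'
    rw [this, sub_re, ofReal_re]
  have hu_re : ∀ w, ‖w‖ = 1 → (u w).re ≤ 0 := by
    intro w hw
    obtain ⟨c, hc, hcu⟩ := hre w hw
    have := re_le_norm c
    nlinarith [hg1 w hw, sq_nonneg ‖M w‖]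
  have hz0 := re_eq_zero_on_sphere_of_re_nonpos hu_diff hu0 hu_re hz
  obtain ⟨c, hc, hcu⟩ := hre z hz
  have hMz : 0 < ‖M z‖ := norm_pos_iff.2 (prod_one_sub_conj_mul_ne_zero hα hz.le)
  refine (hg1 z hz).antisymm ?_
  have := re_le_norm c
  have h3 : 0 < ‖M z‖ ^ 2 := by positivity
  by_contra! h4
  nlinarith

lemma exists_eq_prod_sub_mul_of_zeros {U : Set ℂ} (hU : IsOpen U) :
    ∀ {m : ℕ} {lam : Fin m → ℂ} (_ : Function.Injective lam) (_ : ∀ j, lam j ∈ U) {G : ℂ → ℂ}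
      (_ : DifferentiableOn ℂ G U) (_ : ∀ j, G (lam j) = 0),
      ∃ q : ℂ → ℂ, DifferentiableOn ℂ q U ∧ ∀ z, G z = (∏ j, (z - lam j)) * q z := by
  intro m
  induction m with
  | zero => exact fun {_} _ _ {G} hG _ => ⟨G, hG, by simp⟩
  | succ n ih =>
    intro lam hinj hmem G hG hzero
    have hslope : ∀ z, (z - lam 0) * dslope G (lam 0) z = G z := fun z => by
      simpa [hzero 0] using sub_smul_dslope G (lam 0) z
    obtain ⟨q, hq, hGq⟩ := ih (lam := fun j => lam j.succ)
      (hinj.comp (Fin.succ_injective n)) (fun j => hmem _) (G := dslope G (lam 0))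
      ((differentiableOn_dslope (hU.mem_nhds (hmem 0))).2 hG) (fun j => by
        have := hslope (lam j.succ)
        rw [hzero, mul_eq_zero, sub_eq_zero] at this
        exact this.resolve_left fun h => Fin.succ_ne_zero j (hinj h))
    refine ⟨q, hq, fun z => ?_⟩
    rw [Fin.prod_univ_succ, mul_assoc, ← hGq, hslope]

/-- A holomorphic function of modulus less than `1` on the closed disc cannot agree with the
monomial of degree `n` at `n + 1` distinct points of the disc. -/
lemma false_of_interpolates_pow {n : ℕ} {lam : Fin (n + 1) → ℂ} (hinj : Function.Injective lam)
    (hlam : ∀ j, ‖lam j‖ < 1) {U : Set ℂ} (hU : IsOpen U) (hUc : closedBall (0 : ℂ) 1 ⊆ U)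
    {g : ℂ → ℂ} (hg : DifferentiableOn ℂ g U) (hg1 : ∀ z, ‖z‖ = 1 → ‖g z‖ < 1)
    (hgl : ∀ j, g (lam j) = lam j ^ n) : False := by
  obtain ⟨q, hq, hgq⟩ := exists_eq_prod_sub_mul_of_zeros hU hinj
    (fun j => hUc (by simpa using (hlam j).le)) (G := fun z => g z - z ^ n)
    (hg.sub (by fun_prop)) (fun j => by simp [hgl])
  set M : ℂ → ℂ := fun z => ∏ j, (1 - conj (lam j) * z)
  set u : ℂ → ℂ := fun z => z * q z / M z
  have hu : DifferentiableOn ℂ u (closedBall 0 1) :=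
    (differentiableOn_id.mul (hq.mono hUc)).div (by fun_prop)
      fun z hz => prod_one_sub_conj_mul_ne_zero hlam (by simpa using hz)
  have hre : ∀ z, ‖z‖ = 1 → (u z).re < 0 := by
    intro z hz
    have hM : M z ≠ 0 := prod_one_sub_conj_mul_ne_zero hlam hz.le
    have hz' : conj z * z = 1 := by simp [conj_mul', hz]
    have h1 : conj z ^ n * g z = 1 + u z * ((‖M z‖ ^ 2 : ℝ) : ℂ) := by
      have h2 := hgq z
      rw [prod_sub_eq_pow_mul_conj lam hz] at h2
      have h3 : conj z ^ n * z ^ n = 1 := by rw [← mul_pow, hz', one_pow]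
      have h4 : u z * ((‖M z‖ ^ 2 : ℝ) : ℂ) = z * q z * conj (M z) := by
        rw [ofReal_pow, ← mul_conj' (M z)]
        simp only [u]
        field_simp
      rw [h4]
      rw [pow_succ] at h2
      linear_combination conj z ^ n * h2 + (1 + z * conj (M z) * q z) * h3
    have h5 : ‖conj z ^ n * g z‖ < 1 := by simpa [hz] using hg1 z hz
    have h6 := (re_le_norm _).trans_lt h5
    rw [h1, add_re, one_re, re_mul_ofReal] at h6
    have : 0 < ‖M z‖ ^ 2 := by positivity
    nlinarith
  have h := re_eq_zero_on_sphere_of_re_nonpos hu (by simp [u]) (fun z hz => (hre z hz).le)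
    (z := 1) (by simp)
  exact (hre 1 (by simp)).ne h

lemma norm_sub_le_norm_one_sub_conj_mul {b w : ℂ} (hb : ‖b‖ < 1) (hw : ‖w‖ ≤ 1) :
    ‖w - b‖ ≤ ‖1 - conj b * w‖ := by
  rw [← sq_le_sq₀ (norm_nonneg _) (norm_nonneg _)]
  have hb2 : ‖b‖ ^ 2 ≤ 1 := pow_le_one₀ (norm_nonneg _) hb.le
  have hw2 : ‖w‖ ^ 2 ≤ 1 := pow_le_one₀ (norm_nonneg _) hw
  simp only [← normSq_eq_norm_sq, normSq_apply, sub_re, sub_im, mul_re, mul_im, conj_re, conj_im,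
    one_re, one_im] at *
  nlinarith [mul_nonneg (sub_nonneg.2 hb2) (sub_nonneg.2 hw2)]

lemma norm_mobius_le_one_s1 {b w : ℂ} (hb : ‖b‖ < 1) (hw : ‖w‖ ≤ 1) : ‖mobius b w‖ ≤ 1 := by
  rw [mobius, norm_div, div_le_one (norm_pos_iff.2 (one_sub_conj_mul_ne_zero_s1 hb hw))]
  exact norm_sub_le_norm_one_sub_conj_mul hb hw

lemma mobius_neg_mobius_s1 {b w : ℂ} (hb : ‖b‖ < 1) (hw : ‖w‖ ≤ 1) :
    mobius (-b) (mobius b w) = w := by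
  have h1 := one_sub_conj_mul_ne_zero_s1 hb hw
  have h2 : 1 - conj b * b ≠ 0 := one_sub_conj_mul_ne_zero_s1 hb hb.le
  have h3 : 1 - conj (-b) * ((w - b) / (1 - conj b * w)) = (1 - conj b * b) / (1 - conj b * w) := by
    rw [map_neg]
    field_simp
    ring
  have h4 : (w - b) / (1 - conj b * w) - -b = w * (1 - conj b * b) / (1 - conj b * w) := by
    rw [sub_neg_eq_add, div_add' _ _ _ h1]
    ring
  rw [mobius, mobius, h3, h4, div_div_div_cancel_right₀ h1, mul_div_cancel_right₀ _ h2]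

lemma norm_mobius_lt_one_s1 {b w : ℂ} (hb : ‖b‖ < 1) (hw : ‖w‖ < 1) :
    ‖mobius b w‖ < 1 := by
  rw [mobius, norm_div, div_lt_one (norm_pos_iff.2 (one_sub_conj_mul_ne_zero_s1 hb hw.le)),
    ← sq_lt_sq₀ (norm_nonneg _) (norm_nonneg _)]
  have hb2 : ‖b‖ ^ 2 < 1 := pow_lt_one₀ (norm_nonneg _) hb two_ne_zero
  have hw2 : ‖w‖ ^ 2 < 1 := pow_lt_one₀ (norm_nonneg _) hw two_ne_zero
  simp only [← normSq_eq_norm_sq, normSq_apply, sub_re, sub_im, mul_re, mul_im, conj_re, conj_im,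
    one_re, one_im] at *
  nlinarith [mul_pos (sub_pos.2 hb2) (sub_pos.2 hw2)]

lemma differentiableAt_mobius {b w : ℂ} (hb : ‖b‖ < 1) (hw : ‖w‖ ≤ 1) :
    DifferentiableAt ℂ (mobius b) w :=
  DifferentiableAt.div (by fun_prop) (by fun_prop) (one_sub_conj_mul_ne_zero_s1 hb hw)

lemma mobius_sub_mobius_isBigO {b : ℂ} (hb : ‖b‖ < 1) :
    (fun p : ℂ × ℂ => mobius b p.1 - mobius b p.2) =O[𝓝 (0, 0)] fun p => p.1 - p.2 := by
  have h : DifferentiableOn ℂ (mobius b) (ball 0 1) := fun w hw =>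
    (differentiableAt_mobius hb (mem_ball_zero_iff.1 hw).le).differentiableWithinAt
  exact (h.analyticAt (ball_mem_nhds 0 one_pos)).hasStrictFDerivAt.isBigO_sub

/-- A bounded function of two variables, holomorphic in each of them near the origin, has mixed
second difference of order `‖x‖ * ‖y‖`. -/
lemma norm_mixed_difference_le {G : ℂ → ℂ → ℂ}
    (hx : ∀ x y, ‖x‖ + ‖y‖ < 1 → DifferentiableAt ℂ (fun t => G t y) x)
    (hy : ∀ x y, ‖x‖ + ‖y‖ < 1 → DifferentiableAt ℂ (fun t => G x t) y)
    (hG : ∀ x y, ‖x‖ + ‖y‖ < 1 → ‖G x y‖ ≤ 1) {x y : ℂ} (hx1 : ‖x‖ < 1 / 2) (hy1 : ‖y‖ < 1 / 2) :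
    ‖(G x y - G x 0) - (G 0 y - G 0 0)‖ ≤ 16 * ‖y‖ * ‖x‖ := by
  have hstep : ∀ t : ℂ, ‖t‖ < 1 / 2 → ‖G t y - G t 0‖ ≤ 4 * ‖y‖ := by
    intro t ht
    have := dist_le_div_mul_dist_of_mapsTo_ball (f := fun s => G t s) (c := 0) (R₁ := 1 / 2)
      (R₂ := 2) (z := y)
      (fun s hs => (hy t s (by
        rw [mem_ball_zero_iff] at hs; linarith)).differentiableWithinAt)
      (fun s hs => by
        rw [mem_ball_zero_iff] at hs
        rw [mem_closedBall, dist_eq_norm]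
        have h1 := hG t s (by linarith)
        have h2 := hG t 0 (by rw [norm_zero]; linarith)
        linarith [norm_sub_le (G t s) (G t 0)])
      (by simpa using hy1)
    rw [dist_eq_norm, dist_eq_norm, sub_zero] at this
    linarith
  have := dist_le_div_mul_dist_of_mapsTo_ball (f := fun s => G s y - G s 0) (c := 0)
    (R₁ := 1 / 2) (R₂ := 8 * ‖y‖) (z := x)
    (fun s hs => by
      rw [mem_ball_zero_iff] at hs
      exact ((hx s y (by linarith)).sub
        (hx s 0 (by rw [norm_zero]; linarith))).differentiableWithinAt)
    (fun s hs => by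
      rw [mem_ball_zero_iff] at hs
      rw [mem_closedBall, dist_eq_norm]
      linarith [norm_sub_le (G s y - G s 0) (G 0 y - G 0 0), hstep s hs, hstep 0 (by simp)])
    (by simpa using hx1)
  rw [dist_eq_norm, dist_eq_norm, sub_zero] at this
  linarith

lemma norm_one_sub_ofReal {a : ℝ} (ha : a ≤ 1) : ‖(1 - a : ℂ)‖ = 1 - a := by
  rw [← ofReal_one, ← ofReal_sub, norm_real, Real.norm_of_nonneg (by linarith)]

/-- Strict form of the Schwarz lemma at a point of `(0, 1)`: either the bound is strict or the map
is a rotation. -/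
lemma norm_lt_or_exists_eq_mul {φ : ℂ → ℂ} (hφ : DifferentiableOn ℂ φ (ball 0 1))
    (hmaps : MapsTo φ (ball 0 1) (closedBall 0 1)) (h0 : φ 0 = 0) {r : ℝ} (hr0 : 0 < r)
    (hr1 : r < 1) : ‖φ r‖ < r ∨ ∃ C : ℂ, ‖C‖ = 1 ∧ ∀ z, ‖z‖ < 1 → φ z = z * C := by
  have hr : ‖(r : ℂ)‖ = r := by simp [hr0.le]
  rcases (norm_le_norm_of_mapsTo_ball hφ hmaps h0 (hr.trans_lt hr1)).lt_or_eq with h | h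
  · exact .inl (h.trans_eq hr)
  · right
    have hr' : (r : ℂ) ≠ 0 := by exact_mod_cast hr0.ne'
    obtain ⟨C, hC, hCφ⟩ := affine_of_mapsTo_ball_of_exists_norm_dslope_eq_div' hφ
      (by rwa [h0]) ⟨(r : ℂ), mem_ball_zero_iff.2 (hr.trans_lt hr1), by
        rw [dslope_of_ne _ hr', slope_def_field, h0, sub_zero, sub_zero, norm_div, h, div_one,
          div_self (norm_ne_zero_iff.2 hr')]⟩
    exact ⟨C, by simpa using hC, fun z hz => by simpa [h0] using hCφ (mem_ball_zero_iff.2 hz)⟩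

lemma exists_norm_add_lt_one {φ ψ : ℂ → ℂ} (hφ : DifferentiableOn ℂ φ (ball 0 1))
    (hφ1 : MapsTo φ (ball 0 1) (closedBall 0 1)) (hφ0 : φ 0 = 0)
    (hψ : DifferentiableOn ℂ ψ (ball 0 1)) (hψ1 : MapsTo ψ (ball 0 1) (closedBall 0 1))
    (hψ0 : ψ 0 = 0) {a : ℝ} (ha0 : 0 < a) (ha1 : a < 1) (p : ℕ) :
    ∃ z : ℂ, ‖z‖ = 1 ∧ ‖φ (a * z ^ p) + ψ ((1 - a) * z ^ (p + 1))‖ < 1 := by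
  have hna : ‖(a : ℂ)‖ = a := by simp [ha0.le]
  have hnb : ‖(1 - a : ℂ)‖ = 1 - a := norm_one_sub_ofReal ha1.le
  have hle1 := norm_le_norm_of_mapsTo_ball hφ hφ1 hφ0 (hna.trans_lt ha1)
  have hle2 := norm_le_norm_of_mapsTo_ball hψ hψ1 hψ0 (z := (1 - a : ℂ)) (by linarith)
  have hψlt := norm_lt_or_exists_eq_mul hψ hψ1 hψ0 (r := 1 - a) (by linarith) (by linarith)
  rw [ofReal_sub, ofReal_one] at hψlt
  rcases norm_lt_or_exists_eq_mul hφ hφ1 hφ0 ha0 ha1 with h | ⟨C, hC, hCφ⟩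
  · refine ⟨1, norm_one, ?_⟩
    simp only [one_pow, mul_one]
    linarith [norm_add_le (φ a) (ψ (1 - a))]
  rcases hψlt with h | ⟨D, hD, hDψ⟩
  · refine ⟨1, norm_one, ?_⟩
    simp only [one_pow, mul_one]
    linarith [norm_add_le (φ a) (ψ (1 - a))]
  have hD0 : D ≠ 0 := norm_ne_zero_iff.1 (by simp [hD])
  have hz : ‖-(C / D)‖ = 1 := by simp [hC, hD]
  refine ⟨-(C / D), hz, ?_⟩
  rw [hCφ _ (by rwa [norm_mul, norm_pow, hz, hna, one_pow, mul_one]), hDψ _ (by rw [norm_mul, norm_pow, hz, hnb]; simpa)]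
  have : (a * (-(C / D)) ^ p) * C + ((1 - a) * (-(C / D)) ^ (p + 1)) * D
      = ((2 * a - 1 : ℝ) : ℂ) * (-(C / D)) ^ p * C := by
    push_cast
    rw [pow_succ]
    field_simp
    ring
  rw [this, norm_mul, norm_mul, norm_pow, hz, hC, one_pow, mul_one, mul_one, norm_real,
    Real.norm_eq_abs, abs_lt]
  constructor <;> linarith

/-- No bounded separately holomorphic function on `{‖x‖ + ‖y‖ < 1}` restricts to a Blaschke product
of degree at most `p + 1` along `z ↦ (a z ^ p, (1 - a) z ^ (p + 1))`. -/
lemma not_isBlaschkeOn_comp {H : ℂ → ℂ → ℂ}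
    (hx : ∀ x y, ‖x‖ + ‖y‖ < 1 → DifferentiableAt ℂ (fun t => H t y) x)
    (hy : ∀ x y, ‖x‖ + ‖y‖ < 1 → DifferentiableAt ℂ (fun t => H x t) y)
    (hH : ∀ x y, ‖x‖ + ‖y‖ < 1 → ‖H x y‖ < 1) {a : ℝ} (ha0 : 0 < a) (ha1 : a < 1)
    {p k : ℕ} (hp : 1 ≤ p) (hk1 : 1 ≤ k) (hk : k ≤ p + 1) :
    ¬ IsBlaschkeOn (fun z => H (a * z ^ p) ((1 - a) * z ^ (p + 1))) k := by
  intro hB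
  have hna : ‖(a : ℂ)‖ = a := by simp [ha0.le]
  have hnb : ‖(1 - a : ℂ)‖ = 1 - a := norm_one_sub_ofReal ha1.le
  set b := H 0 0
  have hb : ‖b‖ < 1 := hH 0 0 (by simp)
  have hb' : ‖-b‖ < 1 := by rwa [norm_neg]
  set G : ℂ → ℂ → ℂ := fun x y => mobius b (H x y)
  have hGx : ∀ x y, ‖x‖ + ‖y‖ < 1 → DifferentiableAt ℂ (fun t => G t y) x := fun x y h =>
    (differentiableAt_mobius hb (hH x y h).le).comp x (f := fun t => H t y) (hx x y h)
  have hGy : ∀ x y, ‖x‖ + ‖y‖ < 1 → DifferentiableAt ℂ (fun t => G x t) y := fun x y h =>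
    (differentiableAt_mobius hb (hH x y h).le).comp y (f := fun t => H x t) (hy x y h)
  have hG : ∀ x y, ‖x‖ + ‖y‖ < 1 → ‖G x y‖ ≤ 1 := fun x y h => norm_mobius_le_one_s1 hb (hH x y h).le
  have hG0 : G 0 0 = 0 := by simp [G, b, mobius]
  set φ : ℂ → ℂ := fun x => G x 0
  set ψ : ℂ → ℂ := fun y => G 0 y
  have hφ : DifferentiableOn ℂ φ (ball 0 1) := fun x hx =>
    (hGx x 0 (by simpa using hx)).differentiableWithinAt
  have hψ : DifferentiableOn ℂ ψ (ball 0 1) := fun x hx =>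
    (hGy 0 x (by simpa using hx)).differentiableWithinAt
  have hφ1 : MapsTo φ (ball 0 1) (closedBall 0 1) := fun x hx =>
    mem_closedBall_zero_iff.2 (hG x 0 (by simpa using hx))
  have hψ1 : MapsTo ψ (ball 0 1) (closedBall 0 1) := fun x hx =>
    mem_closedBall_zero_iff.2 (hG 0 x (by simpa using hx))
  set g : ℂ → ℂ := fun z => φ (a * z ^ p) + ψ ((1 - a) * z ^ (p + 1))
  have hX : ∀ z : ℂ, ‖z‖ ≤ 1 → ‖a * z ^ p‖ ≤ a := fun z hz => by
    rw [norm_mul, hna, norm_pow]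
    exact mul_le_of_le_one_right ha0.le (pow_le_one₀ (norm_nonneg _) hz)
  have hY : ∀ z : ℂ, ‖z‖ ≤ 1 → ‖(1 - a) * z ^ (p + 1)‖ ≤ 1 - a := fun z hz => by
    rw [norm_mul, hnb, norm_pow]
    exact mul_le_of_le_one_right (by linarith) (pow_le_one₀ (norm_nonneg _) hz)
  have hg1 : ∀ z, ‖z‖ ≤ 1 → ‖g z‖ ≤ 1 := fun z hz => by
    have h1 := norm_le_norm_of_mapsTo_ball hφ hφ1 hG0 ((hX z hz).trans_lt ha1)
    have h2 := norm_le_norm_of_mapsTo_ball hψ hψ1 hG0 ((hY z hz).trans_lt (by linarith))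
    linarith [norm_add_le (φ (a * z ^ p)) (ψ ((1 - a) * z ^ (p + 1))), hX z hz, hY z hz]
  have hgd : ∀ z, ‖z‖ ≤ 1 → DifferentiableAt ℂ g z := fun z hz => by
    have h1 : DifferentiableAt ℂ φ (a * z ^ p) :=
      hGx _ 0 (by simpa using (hX z hz).trans_lt ha1)
    have h2 : DifferentiableAt ℂ ψ ((1 - a) * z ^ (p + 1)) :=
      hGy 0 _ (by simpa using (hY z hz).trans_lt (by linarith))
    exact (h1.comp z (f := fun z : ℂ => a * z ^ p) (by fun_prop)).add
      (h2.comp z (f := fun z : ℂ => (1 - a) * z ^ (p + 1)) (by fun_prop))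
  have hsmall : ∀ᶠ z in 𝓝 (0 : ℂ), ‖z‖ < 1 / 2 := by
    filter_upwards [ball_mem_nhds (0 : ℂ) one_half_pos] with z hz
    simpa using hz
  have hdiff : (fun z => g z - G (a * z ^ p) ((1 - a) * z ^ (p + 1)))
      =o[𝓝 0] fun z => z ^ k := by
    have h1 : (fun z => g z - G (a * z ^ p) ((1 - a) * z ^ (p + 1)))
        =O[𝓝 0] fun z => z ^ (2 * p + 1) := by
      refine Asymptotics.IsBigO.of_bound 16 ?_
      filter_upwards [hsmall] with z hz
      have hz1 : ‖z‖ ≤ 1 := by linarith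
      have hXz : ‖a * z ^ p‖ ≤ ‖z‖ ^ p := by
        rw [norm_mul, hna, norm_pow]
        exact mul_le_of_le_one_left (by positivity) ha1.le
      have hYz : ‖(1 - a) * z ^ (p + 1)‖ ≤ ‖z‖ ^ (p + 1) := by
        rw [norm_mul, hnb, norm_pow]
        exact mul_le_of_le_one_left (by positivity) (by linarith)
      have hXs : ‖z‖ ^ p ≤ ‖z‖ := pow_le_of_le_one (norm_nonneg _) hz1 (by omega)
      have hYs : ‖z‖ ^ (p + 1) ≤ ‖z‖ := pow_le_of_le_one (norm_nonneg _) hz1 (by omega)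
      have h := norm_mixed_difference_le hGx hGy hG (hXz.trans_lt (hXs.trans_lt hz))
        (hYz.trans_lt (hYs.trans_lt hz))
      rw [hG0, sub_zero, ← norm_neg] at h
      calc _ = _ := by congr 1; simp only [g, φ, ψ]; ring
        _ ≤ _ := h
        _ ≤ 16 * ‖z‖ ^ (p + 1) * ‖z‖ ^ p := by gcongr
        _ = 16 * ‖z ^ (2 * p + 1)‖ := by rw [norm_pow]; ring
    exact h1.trans_isLittleO (Asymptotics.isLittleO_pow_pow (by omega))
  set g₀ : ℂ → ℂ := fun z => mobius (-b) (g z)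
  have ho : (fun z => g₀ z - H (a * z ^ p) ((1 - a) * z ^ (p + 1))) =o[𝓝 0] fun z => z ^ k := by
    have hg0 : Tendsto g (𝓝 0) (𝓝 0) := by
      have := (hgd 0 (by simp)).continuousAt.tendsto
      have h0 : g 0 = 0 := by
        have hp0 : p ≠ 0 := by omega
        simp [g, φ, ψ, hG0, hp0]
      rwa [h0] at this
    have hk0 : Tendsto (fun z : ℂ => z ^ k) (𝓝 0) (𝓝 0) := by
      have : Continuous fun z : ℂ => z ^ k := by fun_prop
      simpa [show k ≠ 0 by omega] using this.tendsto 0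
    have hG1 : Tendsto (fun z : ℂ => G (a * z ^ p) ((1 - a) * z ^ (p + 1))) (𝓝 0) (𝓝 0) := by
      have := hg0.sub (hdiff.isBigO.trans_tendsto hk0)
      simpa using this
    have h := ((mobius_sub_mobius_isBigO hb').comp_tendsto
      (hg0.prodMk_nhds hG1)).trans_isLittleO hdiff
    refine h.congr' ?_ .rfl
    filter_upwards [hsmall] with z hz
    have hz1 : ‖z‖ < 1 := by linarith
    have h1 : ‖a * z ^ p‖ + ‖(1 - a) * z ^ (p + 1)‖ < 1 := by
      have h2 := hY z hz1.le
      have h3 : ‖a * z ^ p‖ < a := by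
        rw [norm_mul, hna, norm_pow]
        exact mul_lt_of_lt_one_right ha0 (pow_lt_one₀ (norm_nonneg _) hz1 (by omega))
      linarith
    simp only [Function.comp_apply, G, g₀]
    rw [mobius_neg_mobius_s1 hb (hH _ _ h1).le]
  obtain ⟨z, hz, hlt⟩ := exists_norm_add_lt_one hφ hφ1 hG0 hψ hψ1 hG0 ha0 ha1 p
  have h1 := norm_eq_one_of_sub_blaschke_isLittleO (g := g₀) hk1 hB
    (fun z hz => (differentiableAt_mobius hb' (hg1 z hz)).comp z (hgd z hz))
    (fun z hz => norm_mobius_le_one_s1 hb' (hg1 z hz.le)) ho hz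
  exact (norm_mobius_lt_one_s1 hb' hlt).ne h1

/-- For `m ≥ 3` and `0 < a < 1`, the map
`f(λ) = (a λ^{m-2}, (1-a) λ^{m-1})` maps `𝔻` into
`E(1/2,1/2) = {z ∈ ℂ² : |z₁| + |z₂| < 1}`, is an `m`-extremal of it, but is not
an `m`-geodesic of it. -/
theorem extremal_not_geodesic_in_ellipsoid_half_half
    (m : ℕ) (hm : 3 ≤ m) (a : ℝ) (ha0 : 0 < a) (ha1 : a < 1)
    (Ehalf : Set (Fin 2 → ℂ)) (hE : Ehalf = {z | ‖z 0‖ + ‖z 1‖ < 1})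
    (f : ℂ → Fin 2 → ℂ)
    (hf : f = fun z => ![(a : ℂ) * z ^ (m - 2), (1 - (a : ℂ)) * z ^ (m - 1)]) :
    Set.MapsTo f unitDisc Ehalf ∧ IsExtremal Ehalf f m ∧ ¬ IsGeodesic Ehalf f m := by
  obtain ⟨p, rfl⟩ : ∃ p, m = p + 2 := ⟨m - 2, by omega⟩
  simp only [Nat.add_sub_cancel, show p + 2 - 1 = p + 1 by omega] at hf
  subst hE hf
  have hna : ‖(a : ℂ)‖ = a := by simp [ha0.le]
  have hnb : ‖(1 - a : ℂ)‖ = 1 - a := norm_one_sub_ofReal ha1.le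
  refine ⟨fun z hz => ?_, fun lam hinj hlam => ?_, ?_⟩
  · have hz1 : ‖z‖ < 1 := mem_ball_zero_iff.1 hz
    have h1 : a * ‖z‖ ^ p < a :=
      mul_lt_of_lt_one_right ha0 (pow_lt_one₀ (norm_nonneg _) hz1 (by omega))
    have h2 : (1 - a) * ‖z‖ ^ (p + 1) < 1 - a :=
      mul_lt_of_lt_one_right (by linarith) (pow_lt_one₀ (norm_nonneg _) hz1 (by omega))
    simp only [mem_ofPred_eq, Matrix.cons_val_zero, Matrix.cons_val_one, norm_mul, hna, hnb,
      norm_pow]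
    linarith
  · rintro ⟨U, h, hU, hUc, hd, hmaps, hint⟩
    rw [differentiableOn_pi] at hd
    refine false_of_interpolates_pow (g := fun z => z * h z 0 + h z 1) hinj
      (fun j => mem_ball_zero_iff.1 (hlam j)) hU hUc
      ((differentiableOn_id.mul (hd 0)).add (hd 1)) (fun z hz => ?_) (fun j => ?_)
    · have h1 : ‖h z 0‖ + ‖h z 1‖ < 1 := hmaps (hUc (by simp [hz]))
      have h2 := norm_add_le (z * h z 0) (h z 1)
      rw [norm_mul, hz, one_mul] at h2
      exact h2.trans_lt h1
    · simp only [hint, Matrix.cons_val_zero, Matrix.cons_val_one]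
      ring
  · rintro ⟨F, hF, hFm, k, hk1, hk, hB⟩
    have hopen : IsOpen {z : Fin 2 → ℂ | ‖z 0‖ + ‖z 1‖ < 1} :=
      isOpen_lt (by fun_prop) continuous_const
    have hmem : ∀ x y : ℂ, ‖x‖ + ‖y‖ < 1 → ![x, y] ∈ {z : Fin 2 → ℂ | ‖z 0‖ + ‖z 1‖ < 1} :=
      fun x y h => by simpa using h
    have hFd : ∀ x y : ℂ, ‖x‖ + ‖y‖ < 1 → DifferentiableAt ℂ F ![x, y] := fun x y h =>
      hF.differentiableAt (hopen.mem_nhds (hmem x y h))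
    refine not_isBlaschkeOn_comp (H := fun x y => F ![x, y]) (fun x y h => ?_) (fun x y h => ?_)
      (fun x y h => mem_ball_zero_iff.1 (hFm (hmem x y h))) ha0 ha1 (p := p) (by omega) hk1
      (by omega) hB
    · refine (hFd x y h).comp x (f := fun t => ![t, y]) (differentiableAt_pi.2 fun i => ?_)
      fin_cases i <;> simp
    · refine (hFd x y h).comp y (f := fun t => ![x, t]) (differentiableAt_pi.2 fun i => ?_)
      fin_cases i <;> simp
end
end

section
/- Let m ≥ 5 be an integer and let a, b > 0 satisfy 2a² + b = 1. Consider the complex ellipsoid E := {z ∈ ℂ³ : |z₁|² + |z₂|² + |z₃| < 1}. The map f(λ) := (a·λ, a·λ^{m−2}, b·λ^{m−1}) maps 𝔻 into E and is an m-geodesic of E, while the map φ(λ) := f(λ)/λ = (a, a·λ^{m−3}, b·λ^{m−2}) is not an (m−1)-geodesic of E. -/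
open Complex Metric Set Filter

noncomputable section

variable {E : Type*} [NormedAddCommGroup E] [NormedSpace ℂ E]

open Polynomial in
/-- A polynomial which is `O(‖z‖ ^ n)` on the punctured unit disc is divisible by `X ^ n`. -/
theorem X_pow_dvd_of_norm_eval_le (n : ℕ) : ∀ (p : ℂ[X]) (K : ℝ),
    (∀ z : ℂ, z ≠ 0 → ‖z‖ < 1 → ‖p.eval z‖ ≤ K * ‖z‖ ^ n) → X ^ n ∣ p := by
  induction n with
  | zero => intro p K _; simp
  | succ n ih =>
    intro p K h
    have h0 : p.eval 0 = 0 := by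
      have h1 : Tendsto (fun z : ℂ => ‖p.eval z‖) (nhdsWithin 0 {0}ᶜ) (nhds ‖p.eval 0‖) :=
        (p.continuous.norm.tendsto 0).mono_left nhdsWithin_le_nhds
      have h2 : Tendsto (fun z : ℂ => K * ‖z‖ ^ (n + 1)) (nhdsWithin 0 {0}ᶜ) (nhds 0) := by
        have : Continuous fun z : ℂ => K * ‖z‖ ^ (n + 1) := by fun_prop
        simpa using (this.tendsto 0).mono_left nhdsWithin_le_nhds
      have h3 : ∀ᶠ z : ℂ in nhdsWithin 0 {0}ᶜ, ‖p.eval z‖ ≤ K * ‖z‖ ^ (n + 1) := by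
        filter_upwards [self_mem_nhdsWithin,
          mem_nhdsWithin_of_mem_nhds (Metric.ball_mem_nhds (0 : ℂ) one_pos)] with z hz hz1
        exact h z hz (by simpa using hz1)
      exact norm_le_zero_iff.1 (le_of_tendsto_of_tendsto h1 h2 h3)
    obtain ⟨q, rfl⟩ : X ∣ p := by
      rw [X_dvd_iff, coeff_zero_eq_eval_zero, h0]
    rw [pow_succ']
    refine mul_dvd_mul_left X (ih q K fun z hz hz1 => ?_)
    have := h z hz hz1
    have hpos : 0 < ‖z‖ := norm_pos_iff.2 hz
    rw [eval_mul, eval_X, norm_mul, pow_succ'] at this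
    exact le_of_mul_le_mul_left (by linarith) hpos

/-- Second order estimate at the centre for a self-map of the unit disc fixing the origin. -/
theorem norm_sub_mul_le_of_mapsTo_unitDisc {q : ℂ → ℂ} {d : ℂ}
    (hq : DifferentiableOn ℂ q (ball 0 1)) (hmaps : MapsTo q (ball 0 1) (ball 0 1))
    (h0 : q 0 = 0) (hd : HasDerivAt q d 0) :
    ‖d‖ ≤ 1 ∧ ∀ s : ℂ, ‖s‖ < 1 → ‖q s - s * d‖ ≤ 2 * ‖s‖ ^ 2 := by
  have hd1 : ‖d‖ ≤ 1 := by
    rw [← hd.deriv]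
    refine norm_deriv_le_one_of_mapsTo_ball hq ?_ one_pos
    rw [h0]
    exact hmaps.mono_right ball_subset_closedBall
  refine ⟨hd1, fun s hs => ?_⟩
  have key := dist_le_mul_div_pow_of_mapsTo_ball_of_isLittleO (f := fun s => q s - s * d)
    (c := 0) (z := s) (R₁ := 1) (R₂ := 2) (n := 1) (hq.sub (by fun_prop)) ?_ ?_ (by simpa using hs)
  · simpa [h0] using key
  · intro w hw
    have h1 : ‖q w‖ < 1 := by simpa using hmaps hw
    have h2 : ‖w‖ < 1 := by simpa using hw
    have h3 : ‖w * d‖ ≤ 1 := by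
      rw [norm_mul]
      exact mul_le_one₀ h2.le (norm_nonneg _) hd1
    simpa [h0] using (norm_sub_le _ _).trans (by linarith : ‖q w‖ + ‖w * d‖ ≤ 2)
  · have := hasDerivAt_iff_isLittleO.1 hd
    simpa [h0] using this.norm_right

/-- Second order estimate along complex lines for a holomorphic function on an open set `D` with
values in the unit disc. -/
theorem norm_fderiv_le_and_norm_sub_le_of_mapsTo_unitDisc {V : Type*} [NormedAddCommGroup V]
    [NormedSpace ℂ V] {D : Set V} (hD : IsOpen D) {g : V → ℂ} (hg : DifferentiableOn ℂ g D)
    (hmaps : MapsTo g D unitDisc) {p : V} (hp : p ∈ D) (hgp : g p = 0) {v : V}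
    (hv : ∀ s : ℂ, ‖s‖ < 1 → p + s • v ∈ D) :
    ‖fderiv ℂ g p v‖ ≤ 1 ∧
      ∀ s : ℂ, ‖s‖ < 1 → ‖g (p + s • v) - s * fderiv ℂ g p v‖ ≤ 2 * ‖s‖ ^ 2 := by
  have hline : ∀ s : ℂ, HasDerivAt (fun s : ℂ => p + s • v) v s := fun s => by
    simpa using ((hasDerivAt_id s).smul_const v).const_add p
  refine norm_sub_mul_le_of_mapsTo_unitDisc (q := fun s => g (p + s • v)) ?_ ?_ (by simpa) ?_
  · intro s hs
    have hs' : p + s • v ∈ D := hv s (by simpa using hs)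
    exact (((hg.differentiableAt (hD.mem_nhds hs')).comp s
      (hline s).differentiableAt)).differentiableWithinAt
  · intro s hs
    exact hmaps (hv s (by simpa using hs))
  · have h1 : HasFDerivAt g (fderiv ℂ g p) (p + (0 : ℂ) • v) := by
      simpa using (hg.differentiableAt (hD.mem_nhds hp)).hasFDerivAt
    exact h1.comp_hasDerivAt 0 (hline 0)

/-- The denominator of a Möbius function does not vanish on the unit disc. -/
theorem one_sub_conj_mul_ne_zero_s4 {c w : ℂ} (hc : ‖c‖ < 1) (hw : ‖w‖ < 1) :
    1 - (starRingEnd ℂ) c * w ≠ 0 := by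
  intro h
  have h1 : ‖(starRingEnd ℂ) c * w‖ = 1 := by rw [← sub_eq_zero.1 h, norm_one]
  rw [norm_mul, RCLike.norm_conj] at h1
  nlinarith [norm_nonneg c, norm_nonneg w]

/-- Möbius functions map the unit disc to itself. -/
theorem mapsTo_mobius_unitDisc {c : ℂ} (hc : ‖c‖ < 1) :
    MapsTo (mobius c) unitDisc unitDisc := by
  intro w hw
  have hw : ‖w‖ < 1 := by simpa [unitDisc] using hw
  have hne := one_sub_conj_mul_ne_zero_s4 hc hw
  have hid : ‖1 - (starRingEnd ℂ) c * w‖ ^ 2 - ‖w - c‖ ^ 2 = (1 - ‖c‖ ^ 2) * (1 - ‖w‖ ^ 2) := by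
    simp only [← Complex.normSq_eq_norm_sq, Complex.normSq_apply]
    simp
    ring
  have h1 : ‖w - c‖ < ‖1 - (starRingEnd ℂ) c * w‖ := by
    refine lt_of_pow_lt_pow_left₀ 2 (norm_nonneg _) ?_
    have : 0 < (1 - ‖c‖ ^ 2) * (1 - ‖w‖ ^ 2) :=
      mul_pos (by nlinarith [norm_nonneg c]) (by nlinarith [norm_nonneg w])
    linarith
  simp only [unitDisc, mem_ball_zero_iff, mobius, norm_div]
  exact (div_lt_one (norm_pos_iff.2 hne)).2 h1

theorem differentiableOn_mobius_s4 {c : ℂ} (hc : ‖c‖ < 1) :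
    DifferentiableOn ℂ (mobius c) unitDisc := by
  refine DifferentiableOn.div (by fun_prop) (by fun_prop) fun w hw => ?_
  exact one_sub_conj_mul_ne_zero_s4 hc (by simpa [unitDisc] using hw)

open Polynomial ComplexConjugate in
/-- Let `B` be a Blaschke product of degree `k ≤ n + 1` with `m_c ∘ B` equal to
`A z ^ n + C z ^ (n + 1)` up to higher order terms. Then `|A|, |C| < 1` forces
`|A| + |C| > 1`. -/
theorem one_lt_norm_add_norm_of_blaschke {n k : ℕ} (hk : k ≤ n + 1) {ζ c A C : ℂ}
    {α : Fin k → ℂ} {B : ℂ → ℂ} (hζ : ‖ζ‖ = 1) (hα : ∀ j, ‖α j‖ < 1) (hc : ‖c‖ < 1)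
    (hB : ∀ z ∈ unitDisc, B z = ζ * ∏ j, mobius (α j) z)
    (hB1 : ∀ z ∈ unitDisc, ‖B z‖ < 1) {K : ℝ}
    (hasymp : ∀ z ∈ unitDisc, ‖mobius c (B z) - z ^ n * (A + C * z)‖ ≤ K * ‖z‖ ^ (n + 2))
    (hA : ‖A‖ < 1) (hC : ‖C‖ < 1) : 1 < ‖A‖ + ‖C‖ := by
  have hζζ : conj ζ * ζ = 1 := by
    rw [← Complex.normSq_eq_conj_mul_self, Complex.normSq_eq_norm_sq, hζ]; simp
  set P : ℂ[X] := ∏ j, (X - Polynomial.C (α j)) with hP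
  set Q : ℂ[X] := ∏ j, (1 - Polynomial.C (conj (α j)) * X) with hQ
  set N : ℂ[X] := Polynomial.C ζ * P - Polynomial.C c * Q with hN
  set M : ℂ[X] := Q - Polynomial.C (conj c * ζ) * P with hM
  have hPev : ∀ z, P.eval z = ∏ j, (z - α j) := fun z => by simp [hP, eval_prod]
  have hQev : ∀ z, Q.eval z = ∏ j, (1 - conj (α j) * z) := fun z => by simp [hQ, eval_prod]
  have hNM : ∀ z ∈ unitDisc, M.eval z ≠ 0 ∧ N.eval z = M.eval z * mobius c (B z) := by
    intro z hz
    have hz1 : ‖z‖ < 1 := by simpa [unitDisc] using hz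
    have hQ0 : Q.eval z ≠ 0 := by
      rw [hQev]
      exact Finset.prod_ne_zero_iff.2 fun j _ => one_sub_conj_mul_ne_zero_s4 (hα j) hz1
    have hBz : B z * Q.eval z = ζ * P.eval z := by
      rw [hB z hz, hPev, hQev]
      simp only [mobius, Finset.prod_div_distrib]
      rw [hQev] at hQ0
      rw [mul_assoc, div_mul_cancel₀ _ hQ0]
    have hne := one_sub_conj_mul_ne_zero_s4 hc (hB1 z hz)
    have hMz : M.eval z = Q.eval z * (1 - conj c * B z) := by
      simp only [hM, eval_sub, eval_mul, eval_C]
      linear_combination conj c * hBz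
    refine ⟨hMz ▸ mul_ne_zero hQ0 hne, ?_⟩
    rw [hMz, mobius, mul_assoc, mul_div_cancel₀ _ hne]
    simp only [hN, eval_sub, eval_mul, eval_C]
    linear_combination -hBz
  have hM0 : M.coeff 0 ≠ 0 := by
    rw [coeff_zero_eq_eval_zero]
    exact (hNM 0 (by simp [unitDisc])).1
  have hNdeg : N.natDegree ≤ n + 1 := by
    have h1 : P.natDegree ≤ k := by
      refine (natDegree_prod_le _ _).trans ((Finset.sum_le_card_nsmul _ _ 1 ?_).trans (by simp))
      intro j _
      simp
    have h2 : Q.natDegree ≤ k := by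
      refine (natDegree_prod_le _ _).trans ((Finset.sum_le_card_nsmul _ _ 1 ?_).trans (by simp))
      intro j _
      exact (natDegree_sub_le _ _).trans
        (max_le (by simp) ((natDegree_C_mul_le _ _).trans natDegree_X_le))
    exact ((natDegree_sub_le _ _).trans (max_le ((natDegree_C_mul_le _ _).trans h1)
      ((natDegree_C_mul_le _ _).trans h2))).trans hk
  have hdvd : X ^ (n + 2) ∣ N - M * (Polynomial.C A + Polynomial.C C * X) * X ^ n := by
    obtain ⟨S, hS⟩ := (isCompact_closedBall (0 : ℂ) 1).exists_bound_of_continuousOn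
      M.continuous.continuousOn
    refine X_pow_dvd_of_norm_eval_le _ _ (S * K) fun z _ hz1 => ?_
    have hz : z ∈ unitDisc := by simpa [unitDisc] using hz1
    have hSz := hS z (by simpa using hz1.le)
    have : (N - M * (Polynomial.C A + Polynomial.C C * X) * X ^ n).eval z
        = M.eval z * (mobius c (B z) - z ^ n * (A + C * z)) := by
      simp only [eval_sub, eval_mul, eval_add, eval_C, eval_X, eval_pow]
      rw [(hNM z hz).2]
      ring
    rw [this, norm_mul, mul_assoc]
    exact mul_le_mul hSz (hasymp z hz) (norm_nonneg _) ((norm_nonneg _).trans hSz)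
  rw [X_pow_dvd_iff] at hdvd
  have hcoeff : ∀ d < n + 2,
      N.coeff d = (M * (Polynomial.C A + Polynomial.C C * X) * X ^ n).coeff d := fun d hd => by
    have := hdvd d hd
    rwa [coeff_sub, sub_eq_zero] at this
  set x := N.coeff n with hx
  set y := N.coeff (n + 1) with hy
  have hxA : x = M.coeff 0 * A := by
    rw [hx, hcoeff n (by omega)]
    simp [coeff_mul_X_pow', mul_add, ← mul_assoc]
  have hyA : y = M.coeff 1 * A + M.coeff 0 * C := by
    rw [hy, hcoeff (n + 1) (by omega)]
    have : n + 1 - n = 0 + 1 := by omega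
    simp only [coeff_mul_X_pow', this, mul_add, ← mul_assoc, coeff_add, coeff_mul_X, coeff_mul_C]
    simp
  have hNeq : N = Polynomial.C x * X ^ n + Polynomial.C y * X ^ (n + 1) := by
    ext d
    simp only [coeff_add, coeff_C_mul, coeff_X_pow]
    rcases lt_trichotomy d n with h | h | h
    · rw [hcoeff d (by omega), coeff_mul_X_pow', if_neg (by omega), if_neg (by omega),
        if_neg (by omega)]
      simp
    · subst h; simp [hx]
    · rcases eq_or_ne d (n + 1) with h' | h'
      · subst h'; simp [hy]
      · rw [coeff_eq_zero_of_natDegree_lt (by omega), if_neg (by omega), if_neg h']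
        simp
  -- the reflection `z ↦ 1 / conj z` exchanges `N` and `M`
  have hrefl : M * X ^ (n + 1 - k) = Polynomial.C (ζ * conj x) * X + Polynomial.C (ζ * conj y) := by
    refine Polynomial.eq_of_infinite_eval_eq _ _ (Set.Infinite.mono (s := {0}ᶜ) ?_
      (Set.finite_singleton (0 : ℂ)).infinite_compl)
    intro z hz
    have hz : z ≠ 0 := hz
    have hPz : z ^ k * conj (P.eval (conj z)⁻¹) = Q.eval z := by
      have : z ^ k = ∏ _j : Fin k, z := by simp
      rw [hPev, hQev, map_prod, this, ← Finset.prod_mul_distrib]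
      refine Finset.prod_congr rfl fun j _ => ?_
      simp only [map_sub, map_inv₀, Complex.conj_conj]
      field_simp
    have hQz : z ^ k * conj (Q.eval (conj z)⁻¹) = P.eval z := by
      have : z ^ k = ∏ _j : Fin k, z := by simp
      rw [hPev, hQev, map_prod, this, ← Finset.prod_mul_distrib]
      refine Finset.prod_congr rfl fun j _ => ?_
      simp only [map_sub, map_mul, map_one, map_inv₀, Complex.conj_conj]
      field_simp
    have hMz : M.eval z = ζ * (z ^ k * conj (N.eval (conj z)⁻¹)) := by
      simp only [hN, hM, eval_sub, eval_mul, eval_C, map_sub, map_mul]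
      rw [← hPz, ← hQz]
      linear_combination -(z ^ k * conj (P.eval (conj z)⁻¹)) * hζζ
    have hNz : z ^ (n + 1) * conj (N.eval (conj z)⁻¹) = conj x * z + conj y := by
      rw [hNeq]
      simp only [eval_add, eval_mul, eval_C, eval_X, eval_pow, map_add, map_mul, map_pow,
        map_inv₀, Complex.conj_conj, inv_pow]
      field_simp
      ring
    change (M * X ^ (n + 1 - k)).eval z = _
    simp only [eval_add, eval_mul, eval_C, eval_X, eval_pow]
    have : z ^ (n + 1) = z ^ k * z ^ (n + 1 - k) := by rw [← pow_add]; congr 1; omega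
    rw [this] at hNz
    rw [hMz]
    linear_combination ζ * hNz
  have hr0 : (M * X ^ (n + 1 - k)).coeff 0 = ζ * conj y := by rw [hrefl]; simp
  have hr1 : (M * X ^ (n + 1 - k)).coeff 1 = ζ * conj x := by
    rw [hrefl]; simp [coeff_C]
  obtain h | h | h : n + 1 - k = 0 ∨ n + 1 - k = 1 ∨ 2 ≤ n + 1 - k := by omega
  · rw [h, pow_zero, mul_one] at hr0 hr1
    rw [hr0] at hxA hyA hM0
    rw [hr1] at hyA
    have hy0 : 0 < ‖y‖ := by
      rw [norm_pos_iff]; rintro h; simp [h] at hM0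
    have e1 : ‖x‖ = ‖y‖ * ‖A‖ := by rw [hxA]; simp [hζ]
    have e2 : (y - ζ * conj x * A) = ζ * conj y * C := by
      linear_combination hyA
    have e3 : ‖y‖ - ‖x‖ * ‖A‖ ≤ ‖y‖ * ‖C‖ := by
      have := norm_sub_norm_le y (ζ * conj x * A)
      rw [e2] at this
      simpa [hζ] using this
    have e4 : 1 - ‖A‖ * ‖A‖ ≤ ‖C‖ := by
      rw [e1] at e3
      refine le_of_mul_le_mul_left ?_ hy0
      linarith
    have hA0 : 0 < ‖A‖ := by
      rcases (norm_nonneg A).eq_or_lt with h | h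
      · rw [← h] at e4; linarith
      · exact h
    nlinarith
  · exfalso
    rw [h, pow_one, coeff_mul_X] at hr1
    have e1 : ‖x‖ = ‖x‖ * ‖A‖ := by
      conv_lhs => rw [hxA, hr1]
      simp [hζ]
    have hx0 : 0 < ‖x‖ := by
      rw [norm_pos_iff]; rintro h; simp [h] at hr1; exact hM0 hr1
    nlinarith
  · exfalso
    rw [coeff_mul_X_pow', if_neg (by omega)] at hr0 hr1
    have hMX : M * X ^ (n + 1 - k) = 0 := by rw [hrefl, ← hr0, ← hr1]; simp
    have hM' : M = 0 := by simpa using hMX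
    rw [hM'] at hM0
    simp at hM0

/-- Every complex number can be rotated onto the nonnegative real axis. -/
theorem exists_norm_eq_one_mul_eq_norm (w : ℂ) : ∃ e : ℂ, ‖e‖ = 1 ∧ e * w = ‖w‖ := by
  rcases eq_or_ne w 0 with rfl | hw
  · exact ⟨1, by simp, by simp⟩
  · refine ⟨‖w‖ / w, ?_, by field_simp⟩
    rw [norm_div, Complex.norm_real, norm_norm, div_self (norm_ne_zero_iff.2 hw)]

/-- For `m ≥ 5` and `a, b > 0` with `2a² + b = 1`, the map
`f(λ) = (aλ, aλ^{m-2}, bλ^{m-1})` maps `𝔻` into the complex ellipsoid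
`E = {z ∈ ℂ³ : |z₁|² + |z₂|² + |z₃| < 1}` and is an `m`-geodesic of `E`, while
`φ(λ) = f(λ)/λ = (a, aλ^{m-3}, bλ^{m-2})` is not an `(m-1)`-geodesic of `E`. -/
theorem geodesic_with_quotient_not_geodesic_in_ellipsoid_1_1_half
    (m : ℕ) (hm : 5 ≤ m) (a b : ℝ) (ha : 0 < a) (hb : 0 < b)
    (hab : 2 * a ^ 2 + b = 1)
    (Eell : Set (Fin 3 → ℂ)) (hE : Eell = {z | ‖z 0‖ ^ 2 + ‖z 1‖ ^ 2 + ‖z 2‖ < 1})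
    (f : ℂ → Fin 3 → ℂ)
    (hf : f = fun z => ![(a : ℂ) * z, (a : ℂ) * z ^ (m - 2), (b : ℂ) * z ^ (m - 1)])
    (φ : ℂ → Fin 3 → ℂ)
    (hφ : φ = fun z => ![(a : ℂ), (a : ℂ) * z ^ (m - 3), (b : ℂ) * z ^ (m - 2)]) :
    Set.MapsTo f unitDisc Eell ∧ IsGeodesic Eell f m ∧ ¬ IsGeodesic Eell φ (m - 1) := by
  have hopen : IsOpen Eell := by
    rw [hE]
    exact isOpen_lt (by fun_prop) continuous_const
  refine ⟨?_, ?_, ?_⟩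
  · intro z hz
    have hz : ‖z‖ < 1 := by simpa [unitDisc] using hz
    have h0 := norm_nonneg z
    have h1 : ‖z‖ ^ 2 < 1 := pow_lt_one₀ h0 hz two_ne_zero
    have h2 : (‖z‖ ^ (m - 2)) ^ 2 ≤ 1 := pow_le_one₀ (by positivity) (pow_le_one₀ h0 hz.le)
    have h3 : ‖z‖ ^ (m - 1) ≤ 1 := pow_le_one₀ h0 hz.le
    simp only [hE, hf, mem_ofPred_eq, Matrix.cons_val_zero, Matrix.cons_val_one, Matrix.cons_val,
      norm_mul, norm_pow, Complex.norm_real, Real.norm_of_nonneg ha.le,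
      Real.norm_of_nonneg hb.le, mul_pow]
    nlinarith [sq_pos_of_pos ha]
  · refine ⟨fun w => 2 * w 0 * w 1 + w 2, by fun_prop, ?_, m - 1, by omega, le_rfl, 1,
      fun _ => 0, by simp, by simp, ?_⟩
    · intro w hw
      simp only [hE, mem_ofPred_eq] at hw
      simp only [unitDisc, mem_ball_zero_iff]
      calc ‖2 * w 0 * w 1 + w 2‖ ≤ ‖2 * w 0 * w 1‖ + ‖w 2‖ := norm_add_le _ _
        _ = 2 * ‖w 0‖ * ‖w 1‖ + ‖w 2‖ := by simp
        _ < 1 := by nlinarith [sq_nonneg (‖w 0‖ - ‖w 1‖)]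
    · intro z _
      have hab' : 2 * (a : ℂ) ^ 2 + b = 1 := by exact_mod_cast hab
      have hpow : z ^ (m - 1) = z * z ^ (m - 2) := by rw [← pow_succ']; congr 1; omega
      simp only [hf, mobius, Matrix.cons_val_zero, Matrix.cons_val_one, Matrix.cons_val, sub_zero,
        map_zero, zero_mul, div_one, Finset.prod_const, Finset.card_univ, Fintype.card_fin, one_mul]
      rw [hpow]
      linear_combination (z * z ^ (m - 2)) * hab'
  · rintro ⟨F, hFd, hFm, k, -, hk, ζ, α, hζ, hα, hB⟩
    set p : Fin 3 → ℂ := ![(a : ℂ), 0, 0] with hp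
    have ha2 := sq_pos_of_pos ha
    have hmem : ∀ v₁ v₂ : ℂ, ‖v₁‖ ^ 2 + ‖v₂‖ ≤ 1 - a ^ 2 → ∀ s : ℂ, ‖s‖ < 1 →
        p + s • ![0, v₁, v₂] ∈ Eell := by
      intro v₁ v₂ hv s hs
      have hs0 := norm_nonneg s
      simp only [hE, hp, mem_ofPred_eq, Pi.add_apply, Pi.smul_apply, smul_eq_mul,
        Matrix.cons_val_zero, Matrix.cons_val_one, Matrix.cons_val, mul_zero, add_zero, zero_add,
        norm_mul, Complex.norm_real, Real.norm_of_nonneg ha.le]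
      have h1 : (‖s‖ * ‖v₁‖) ^ 2 ≤ ‖s‖ * ‖v₁‖ ^ 2 := by
        rw [mul_pow]
        exact mul_le_mul_of_nonneg_right (by nlinarith) (sq_nonneg _)
      nlinarith
    have hpE : p ∈ Eell := by
      simpa using hmem 0 0 (by rw [norm_zero]; linarith) 0 (by simp)
    set c := F p with hc
    have hc1 : ‖c‖ < 1 := by simpa [unitDisc] using hFm hpE
    set g : (Fin 3 → ℂ) → ℂ := fun w => mobius c (F w) with hg
    have hgd : DifferentiableOn ℂ g Eell := (differentiableOn_mobius_s4 hc1).comp hFd hFm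
    have hgm : MapsTo g Eell unitDisc := (mapsTo_mobius_unitDisc hc1).comp hFm
    have hgp : g p = 0 := by simp [hg, mobius, hc]
    set L := fderiv ℂ g p with hL
    set A := L ![0, 1, 0] with hA
    set C := L ![0, 0, 1] with hC
    have hLv : ∀ v₁ v₂ : ℂ, L ![0, v₁, v₂] = v₁ * A + v₂ * C := by
      intro v₁ v₂
      have : (![0, v₁, v₂] : Fin 3 → ℂ) = v₁ • ![0, 1, 0] + v₂ • ![0, 0, 1] := by
        ext i; fin_cases i <;> simp
      rw [this, map_add, map_smul, map_smul, smul_eq_mul, smul_eq_mul]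
    have key : ∀ v₁ v₂ : ℂ, ‖v₁‖ ^ 2 + ‖v₂‖ ≤ 1 - a ^ 2 → ‖v₁ * A + v₂ * C‖ ≤ 1 ∧
        ∀ s : ℂ, ‖s‖ < 1 →
          ‖g (p + s • ![0, v₁, v₂]) - s * (v₁ * A + v₂ * C)‖ ≤ 2 * ‖s‖ ^ 2 := by
      intro v₁ v₂ hv
      rw [← hLv]
      exact norm_fderiv_le_and_norm_sub_le_of_mapsTo_unitDisc hopen hgd hgm hpE hgp (hmem v₁ v₂ hv)
    have hA1 : ‖(a : ℂ) * A‖ < 1 := by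
      set r := √(1 - a ^ 2) with hr
      have hr2 : r ^ 2 = 1 - a ^ 2 := Real.sq_sqrt (by nlinarith)
      have hr0 : 0 ≤ r := Real.sqrt_nonneg _
      have har : a < r := lt_of_pow_lt_pow_left₀ 2 hr0 (by linarith)
      have h := (key r 0 (by simp [hr2])).1
      simp only [zero_mul, add_zero, norm_mul, Complex.norm_real, Real.norm_of_nonneg hr0] at h
      rw [norm_mul, Complex.norm_real, Real.norm_of_nonneg ha.le]
      rcases (norm_nonneg A).eq_or_lt with h0 | h0
      · rw [← h0]; simp
      · nlinarith
    have hC1 : ‖(b : ℂ) * C‖ < 1 := by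
      have hr0 : 0 ≤ 1 - a ^ 2 := by linarith
      have h := (key 0 ((1 - a ^ 2 : ℝ) : ℂ) (by
        rw [Complex.norm_real, Real.norm_of_nonneg hr0]; simp)).1
      rw [zero_mul, zero_add, norm_mul, Complex.norm_real, Real.norm_of_nonneg hr0] at h
      rw [norm_mul, Complex.norm_real, Real.norm_of_nonneg hb.le]
      rcases (norm_nonneg C).eq_or_lt with h0 | h0
      · rw [← h0]; simp
      · nlinarith
    have hAC : ‖(a : ℂ) * A‖ + ‖(b : ℂ) * C‖ ≤ 1 := by
      obtain ⟨e₁, he₁, h₁⟩ := exists_norm_eq_one_mul_eq_norm ((a : ℂ) * A)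
      obtain ⟨e₂, he₂, h₂⟩ := exists_norm_eq_one_mul_eq_norm ((b : ℂ) * C)
      have h := (key (e₁ * a) (e₂ * b) (by
        simp only [norm_mul, he₁, he₂, Complex.norm_real, Real.norm_of_nonneg ha.le,
          Real.norm_of_nonneg hb.le]
        linarith)).1
      rw [mul_assoc, h₁, mul_assoc, h₂, ← Complex.ofReal_add, Complex.norm_real] at h
      exact (le_abs_self _).trans h
    have hφp : ∀ z, φ z = p + (z ^ (m - 3)) • ![0, (a : ℂ), b * z] := by
      intro z
      have hpow : z ^ (m - 2) = z ^ (m - 3) * z := by rw [← pow_succ]; congr 1; omega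
      ext i
      fin_cases i <;> simp [hφ, hp, hpow] <;> ring
    have hz2 : ∀ z ∈ unitDisc, ‖(a : ℂ)‖ ^ 2 + ‖(b : ℂ) * z‖ ≤ 1 - a ^ 2 ∧
        ‖z ^ (m - 3)‖ < 1 := by
      intro z hz
      have hz : ‖z‖ < 1 := by simpa [unitDisc] using hz
      simp only [norm_mul, norm_pow, Complex.norm_real, Real.norm_of_nonneg ha.le,
        Real.norm_of_nonneg hb.le]
      exact ⟨by nlinarith, pow_lt_one₀ (norm_nonneg z) hz (by omega)⟩
    refine hAC.not_gt (one_lt_norm_add_norm_of_blaschke (n := m - 3) (by omega) hζ hα hc1 hB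
      ?_ (K := 2) ?_ hA1 hC1)
    · intro z hz
      have := hFm (hmem _ _ (hz2 z hz).1 _ (hz2 z hz).2)
      rw [← hφp] at this
      simpa [unitDisc] using this
    · intro z hz
      have hz1 : ‖z‖ < 1 := by simpa [unitDisc] using hz
      have h := (key _ _ (hz2 z hz).1).2 _ (hz2 z hz).2
      rw [← hφp] at h
      refine le_trans (le_of_eq ?_) (h.trans ?_)
      · congr 1
        simp only [hg]
        ring
      · rw [norm_pow, ← pow_mul]
        exact mul_le_mul_of_nonneg_left
          (pow_le_pow_of_le_one (norm_nonneg z) hz1.le (by omega)) two_pos.le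
end
end
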